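/- arXiv:1404.6711 — 3 statements merged into one kernel-verified Lean document; each statement's English description precedes it below -/
import Mathlib

section
/- Let R be a commutative noetherian ring, let 𝔞 be an ideal of R, and let 𝒮 be a Serre subcategory of R-modules satisfying the C_𝔞 condition. If M is a finitely generated R-module with M ∈ 𝒮, then the local cohomology module H^i_𝔞(M) belongs to 𝒮 for every i ≥ 0. -/
universe u

open Submodule

variable {R : Type u} [CommRing R]

/-- `Γ_a(M)`, the `a`-torsion submodule of `M`: the set of elements annihilated by
some power of the ideal `a`. -/
def torsionGamma (a : Ideal R) (M : Type u) [AddCommGroup M] [Module R M] :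
    Submodule R M :=
  ⨆ n : ℕ, Submodule.torsionBySet R M ((a ^ n : Ideal R) : Set R)

/-- The class `S` satisfies the condition `C_a` on the module `M`:
if `Γ_a(M) = M` and `(0 :_M a) ∈ S` then `M ∈ S`. -/
def CCondOn (S : ModuleCat.{u} R → Prop) (a : Ideal R) (M : ModuleCat.{u} R) : Prop :=
  torsionGamma a M = ⊤ →
    S (ModuleCat.of R (Submodule.torsionBySet R M (a : Set R))) → S M

/-- The class `S` satisfies the condition `C_a` (on every `R`-module). -/
def CCond (S : ModuleCat.{u} R → Prop) (a : Ideal R) : Prop :=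
  ∀ M : ModuleCat.{u} R, CCondOn S a M

/-- The class `S` is closed under isomorphisms of `R`-modules. -/
def IsoClosed (S : ModuleCat.{u} R → Prop) : Prop :=
  ∀ ⦃M N : ModuleCat.{u} R⦄, (M ≃ₗ[R] N) → S M → S N

/-- `S` is a Serre subcategory of the category of `R`-modules: it is closed under
isomorphisms, contains the zero module, and is closed under submodules, quotient modules
and extensions. -/
structure IsSerreClass (S : ModuleCat.{u} R → Prop) : Prop where
  iso : IsoClosed S
  zero : ∀ M : ModuleCat.{u} R, Subsingleton M → S M
  subobj : ∀ (M : ModuleCat.{u} R) (N : Submodule R M), S M → S (ModuleCat.of R N)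
  quot : ∀ (M : ModuleCat.{u} R) (N : Submodule R M), S M → S (ModuleCat.of R (M ⧸ N))
  extension : ∀ (M : ModuleCat.{u} R) (N : Submodule R M),
    S (ModuleCat.of R N) → S (ModuleCat.of R (M ⧸ N)) → S M

noncomputable section

open CategoryTheory Abelian Opposite

lemma CategoryTheory.ProjectiveResolution.extMk_zero_degree_eq_zero_iff {X Y : ModuleCat.{u} R}
    (P : ProjectiveResolution X) (f : P.complex.X 0 ⟶ Y) (hf : P.complex.d 1 0 ≫ f = 0) :
    P.extMk f 1 rfl hf = 0 ↔ f = 0 := by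
  refine ⟨fun h => ?_, by rintro rfl; simp⟩
  rw [← P.extEquivCohomologyClass.apply_eq_iff_eq, P.extEquivCohomologyClass_extMk,
    P.extEquivCohomologyClass_zero, CochainComplex.HomComplex.CohomologyClass.mk_eq_zero_iff,
    CochainComplex.HomComplex.Cocycle.toSingleMk_mem_coboundaries_iff _ _ _ _ _ 1 (by simp)] at h
  obtain ⟨g, hg⟩ := h
  have hz : g = 0 := (P.cochainComplex.isZero_of_isStrictlyLE 0 1).eq_of_src _ _
  rw [hz, Limits.comp_zero] at hg
  exact (cancel_epi _).1 (hg.symm.trans Limits.comp_zero.symm)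

/-- The linear map sending a cocycle on a projective resolution of `X` to its class in
`Abelian.Ext X Y n`. -/
def cocyclesToExt {X : ModuleCat.{u} R} (P : ProjectiveResolution X) (Y : ModuleCat.{u} R)
    (n : ℕ) : LinearMap.ker (Linear.leftComp R Y (P.complex.d (n + 1) n)) →ₗ[R]
      Abelian.Ext.{u} X Y n where
  toFun f := P.extMk f.1 (n + 1) rfl f.2
  map_add' f g := (P.add_extMk f.1 g.1 (n + 1) rfl f.2 g.2).symm
  map_smul' r f := by
    refine Eq.trans ?_ ((P.extMk_comp_mk₀ f.1 (n + 1) rfl f.2 (r • 𝟙 Y)).symm.trans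
      (Ext.smul_eq_comp_mk₀ _ _).symm)
    congr 1

lemma d_comp_iCycles_apply {X : ModuleCat.{u} R} (P : ProjectiveResolution X)
    (Y : ModuleCat.{u} R) (n : ℕ) (z : (P.complex.linearYonedaObj R Y).cycles n) :
    P.complex.d (n + 1) n ≫ (P.complex.linearYonedaObj R Y).iCycles n z = 0 :=
  ConcreteCategory.congr_hom ((P.complex.linearYonedaObj R Y).iCycles_d n (n + 1)) z

/-- The linear map sending a cycle of `Hom(P, Y)` to its class in `Abelian.Ext X Y n`. -/
def cyclesToExt {X : ModuleCat.{u} R} (P : ProjectiveResolution X) (Y : ModuleCat.{u} R) (n : ℕ) :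
    (P.complex.linearYonedaObj R Y).cycles n ⟶ ModuleCat.of R (Abelian.Ext.{u} X Y n) :=
  ModuleCat.ofHom (cocyclesToExt P Y n ∘ₗ
    ((P.complex.linearYonedaObj R Y).iCycles n).hom.codRestrict _ (d_comp_iCycles_apply P Y n))

lemma cyclesToExt_surjective {X : ModuleCat.{u} R} (P : ProjectiveResolution X)
    (Y : ModuleCat.{u} R) (n : ℕ) : Function.Surjective (cyclesToExt P Y n) := by
  intro x
  obtain ⟨f, hf, rfl⟩ := P.extMk_surjective x (n + 1) rfl
  have hex : (ShortComplex.mk ((P.complex.linearYonedaObj R Y).iCycles n)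
      ((P.complex.linearYonedaObj R Y).d n (n + 1))
      (HomologicalComplex.iCycles_d _ _ _)).Exact :=
    ShortComplex.exact_of_f_is_kernel _
      ((P.complex.linearYonedaObj R Y).cyclesIsKernel n (n + 1) (by simp))
  obtain ⟨z, hz⟩ := (ShortComplex.moduleCat_exact_iff _).1 hex f hf
  refine ⟨z, ?_⟩
  subst hz
  rfl

lemma extMk_eq_zero_of_eq_zero {X : ModuleCat.{u} R} (P : ProjectiveResolution X)
    {Y : ModuleCat.{u} R} {n : ℕ} (f : P.complex.X n ⟶ Y) (hf : P.complex.d (n + 1) n ≫ f = 0)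
    (h : f = 0) : P.extMk f (n + 1) rfl hf = 0 := by
  subst h
  simp

lemma toCycles_comp_cyclesToExt {X : ModuleCat.{u} R} (P : ProjectiveResolution X)
    (Y : ModuleCat.{u} R) (m n : ℕ) :
    (P.complex.linearYonedaObj R Y).toCycles m n ≫ cyclesToExt P Y n = 0 := by
  ext g
  have hg : (P.complex.linearYonedaObj R Y).iCycles n
      ((P.complex.linearYonedaObj R Y).toCycles m n g) = P.complex.d n m ≫ g :=
    ConcreteCategory.congr_hom ((P.complex.linearYonedaObj R Y).toCycles_i m n) g
  change P.extMk _ (n + 1) rfl (d_comp_iCycles_apply P Y n _) = 0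
  by_cases hmn : m + 1 = n
  · exact (P.extMk_eq_zero_iff _ _ rfl _ m hmn).2 ⟨g, hg.symm⟩
  · refine extMk_eq_zero_of_eq_zero P _ _ (hg.trans ?_)
    rw [P.complex.shape n m (by simpa using hmn)]
    exact Limits.zero_comp

lemma homologyπ_eq_zero_of_cyclesToExt_eq_zero {X : ModuleCat.{u} R} (P : ProjectiveResolution X)
    (Y : ModuleCat.{u} R) (n : ℕ) (z : (P.complex.linearYonedaObj R Y).cycles n)
    (hz : cyclesToExt P Y n z = 0) : (P.complex.linearYonedaObj R Y).homologyπ n z = 0 := by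
  have hinj : Function.Injective ((P.complex.linearYonedaObj R Y).iCycles n) :=
    (ModuleCat.mono_iff_injective _).1 inferInstance
  change P.extMk _ (n + 1) rfl (d_comp_iCycles_apply P Y n z) = 0 at hz
  obtain _ | n := n
  · have hz' := (P.extMk_zero_degree_eq_zero_iff _ _).1 hz
    rw [hinj (hz'.trans (map_zero _).symm), map_zero]
  · obtain ⟨g, hg⟩ := (P.extMk_eq_zero_iff _ _ _ _ n rfl).1 hz
    have : z = (P.complex.linearYonedaObj R Y).toCycles n (n + 1) g :=
      hinj (hg.symm.trans (ConcreteCategory.congr_hom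
        ((P.complex.linearYonedaObj R Y).toCycles_i n (n + 1)) g).symm)
    rw [this]
    exact ConcreteCategory.congr_hom
      ((P.complex.linearYonedaObj R Y).toCycles_comp_homologyπ n (n + 1)) g

/-- The comparison map from the cohomology of `Hom(P, Y)` to `Abelian.Ext X Y n`. -/
def homologyToExt {X : ModuleCat.{u} R} (P : ProjectiveResolution X) (Y : ModuleCat.{u} R)
    (n : ℕ) : (P.complex.linearYonedaObj R Y).homology n ⟶
      ModuleCat.of R (Abelian.Ext.{u} X Y n) :=
  ((P.complex.linearYonedaObj R Y).homologyIsCokernel _ n rfl).desc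
    (Limits.CokernelCofork.ofπ (cyclesToExt P Y n) (toCycles_comp_cyclesToExt P Y _ n))

lemma homologyπ_homologyToExt {X : ModuleCat.{u} R} (P : ProjectiveResolution X)
    (Y : ModuleCat.{u} R) (n : ℕ) :
    (P.complex.linearYonedaObj R Y).homologyπ n ≫ homologyToExt P Y n = cyclesToExt P Y n :=
  Limits.Cofork.IsColimit.π_desc
    ((P.complex.linearYonedaObj R Y).homologyIsCokernel _ n rfl)

instance {X : ModuleCat.{u} R} (P : ProjectiveResolution X) (Y : ModuleCat.{u} R) (n : ℕ) :
    IsIso (homologyToExt P Y n) := by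
  have hπ (z) : homologyToExt P Y n ((P.complex.linearYonedaObj R Y).homologyπ n z) =
      cyclesToExt P Y n z := ConcreteCategory.congr_hom (homologyπ_homologyToExt P Y n) z
  have hsurj : Function.Surjective ((P.complex.linearYonedaObj R Y).homologyπ n) :=
    (ModuleCat.epi_iff_surjective _).1 inferInstance
  refine (ConcreteCategory.isIso_iff_bijective _).2 ⟨?_, fun x => ?_⟩
  · refine (injective_iff_map_eq_zero _).2 fun x hx => ?_
    obtain ⟨z, rfl⟩ := hsurj x
    exact homologyπ_eq_zero_of_cyclesToExt_eq_zero P Y n z ((hπ z).symm.trans hx)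
  · obtain ⟨z, rfl⟩ := cyclesToExt_surjective P Y n x
    exact ⟨_, hπ z⟩

lemma homologyUnop_naturality {K L : HomologicalComplex (ModuleCat.{u} R)ᵒᵖ (ComplexShape.down ℕ)}
    (ψ : K ⟶ L) (n : ℕ) :
    (L.homologyUnop n).hom ≫ (HomologicalComplex.homologyMap ψ n).unop =
      HomologicalComplex.homologyMap ((HomologicalComplex.unopFunctor _ _).map ψ.op) n ≫
        (K.homologyUnop n).hom := by
  have := HomologicalComplex.homologyOp_hom_naturality
    ((HomologicalComplex.unopFunctor _ _).map ψ.op) n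
  exact (congrArg Quiver.Hom.unop this)

/-- The morphism of complexes `Hom(Q, Y) ⟶ Hom(P, Y)` induced by a morphism of complexes. -/
def linearYonedaMap {K L : ChainComplex (ModuleCat.{u} R) ℕ} (φ : K ⟶ L) (Y : ModuleCat.{u} R) :
    L.linearYonedaObj R Y ⟶ K.linearYonedaObj R Y :=
  (HomologicalComplex.unopFunctor _ _).map
    ((((linearYoneda R (ModuleCat.{u} R)).obj Y).rightOp.mapHomologicalComplex _).map φ).op

lemma comp_inv_eq_of_commSq {D : Type*} [Category* D] {A B B' C C' E : D} {f : A ⟶ B}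
    {g : B ⟶ C} {h : A ⟶ B'} {k : B' ⟶ C} {e : E ≅ C} {e' : C' ≅ B'} {l : C' ⟶ E}
    (h₁ : f ≫ g = h ≫ k) (h₂ : e'.hom ≫ k = l ≫ e.hom) :
    f ≫ g ≫ e.inv = (h ≫ e'.inv) ≫ l := by
  have : k ≫ e.inv = e'.inv ≫ l := by
    rw [Iso.comp_inv_eq, Category.assoc, ← h₂, Iso.inv_hom_id_assoc]
  rw [← Category.assoc, h₁, Category.assoc, Category.assoc, this]

lemma isoExt_naturality {X X' : ModuleCat.{u} R} (P : ProjectiveResolution X)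
    (P' : ProjectiveResolution X') (g : X ⟶ X') (φ : ProjectiveResolution.Hom P P' g)
    (Y : ModuleCat.{u} R) (n : ℕ) :
    ((Ext R (ModuleCat.{u} R) n).map g.op).app Y ≫ (P.isoExt (R := R) n Y).hom =
      (P'.isoExt n Y).hom ≫ HomologicalComplex.homologyMap (linearYonedaMap φ.hom Y) n := by
  have h1 := congrArg Quiver.Hom.unop (P.isoLeftDerivedObj_inv_naturality g P' φ.hom
    (by simpa using φ.hom_f_zero_comp_π_f_zero)
    ((linearYoneda R (ModuleCat.{u} R)).obj Y).rightOp n)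
  have h2 := homologyUnop_naturality
    ((((linearYoneda R (ModuleCat.{u} R)).obj Y).rightOp.mapHomologicalComplex _).map φ.hom) n
  have e1 : (P.isoExt (R := R) n Y).hom =
    (P.isoLeftDerivedObj ((linearYoneda R (ModuleCat.{u} R)).obj Y).rightOp n).inv.unop ≫
      (HomologicalComplex.homologyUnop _ _).inv := rfl
  have e2 : (P'.isoExt (R := R) n Y).hom =
    (P'.isoLeftDerivedObj ((linearYoneda R (ModuleCat.{u} R)).obj Y).rightOp n).inv.unop ≫
      (HomologicalComplex.homologyUnop _ _).inv := rfl
  have e3 : ((Ext R (ModuleCat.{u} R) n).map g.op).app Y =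
    ((((linearYoneda R (ModuleCat.{u} R)).obj Y).rightOp.leftDerived n).map g).unop := rfl
  rw [e1, e2, e3]
  exact comp_inv_eq_of_commSq h1 h2

lemma homologyToExt_naturality {X X' : ModuleCat.{u} R} (P : ProjectiveResolution X)
    (P' : ProjectiveResolution X') (g : X ⟶ X') (φ : ProjectiveResolution.Hom P P' g)
    (Y : ModuleCat.{u} R) (n : ℕ) :
    HomologicalComplex.homologyMap (linearYonedaMap φ.hom Y) n ≫ homologyToExt P Y n =
      homologyToExt P' Y n ≫ ModuleCat.ofHom ((Ext.mk₀ g).precompOfLinear R Y (zero_add n)) := by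
  rw [← cancel_epi ((P'.complex.linearYonedaObj R Y).homologyπ n),
    HomologicalComplex.homologyπ_naturality_assoc, homologyπ_homologyToExt,
    ← Category.assoc, homologyπ_homologyToExt]
  ext z
  refine Eq.trans ?_ (ProjectiveResolution.mk₀_comp_extMk _ _ rfl
    (d_comp_iCycles_apply P' Y n z) φ).symm
  change P.extMk _ (n + 1) rfl (d_comp_iCycles_apply P Y n _) = _
  congr 1
  exact ConcreteCategory.congr_hom
    (HomologicalComplex.cyclesMap_i (linearYonedaMap φ.hom Y) n) z

/-- The two definitions of `Ext` in the category of `R`-modules agree. -/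
def leftDerivedExtIso (X Y : ModuleCat.{u} R) (n : ℕ) :
    ((Ext R (ModuleCat.{u} R) n).obj (op X)).obj Y ≅ ModuleCat.of R (Abelian.Ext.{u} X Y n) :=
  (projectiveResolution X).isoExt n Y ≪≫ asIso (homologyToExt (projectiveResolution X) Y n)

lemma leftDerivedExtIso_naturality {X X' : ModuleCat.{u} R} (g : X ⟶ X') (Y : ModuleCat.{u} R)
    (n : ℕ) : ((Ext R (ModuleCat.{u} R) n).map g.op).app Y ≫ (leftDerivedExtIso X Y n).hom =
      (leftDerivedExtIso X' Y n).hom ≫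
        ModuleCat.ofHom ((Ext.mk₀ g).precompOfLinear R Y (zero_add n)) := by
  let φ : ProjectiveResolution.Hom (projectiveResolution X) (projectiveResolution X') g :=
    { hom := ProjectiveResolution.lift g _ _
      hom_f_zero_comp_π_f_zero :=
        HomologicalComplex.congr_hom (ProjectiveResolution.lift_commutes g _ _) 0 }
  simp only [leftDerivedExtIso, Iso.trans_hom, asIso_hom, Category.assoc]
  rw [← homologyToExt_naturality _ _ g φ, ← Category.assoc, isoExt_naturality _ _ g φ,
    Category.assoc]

/-- The module `R ⧸ a ^ t`. -/
abbrev powQuot (a : Ideal R) (t : ℕ) : ModuleCat.{u} R := ModuleCat.of R (R ⧸ a ^ t)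

/-- The canonical projection `R ⧸ a ^ t ⟶ R ⧸ a ^ s` for `s ≤ t`. -/
def powQuotMap (a : Ideal R) {s t : ℕ} (h : s ≤ t) : powQuot a t ⟶ powQuot a s :=
  ModuleCat.ofHom (Submodule.mapQ _ _ LinearMap.id (Ideal.pow_le_pow_right h))

lemma powQuotMap_self (a : Ideal R) (t : ℕ) : powQuotMap a (le_refl t) = 𝟙 _ := by
  ext
  rfl

lemma powQuotMap_comp (a : Ideal R) {s t r : ℕ} (h : s ≤ t) (h' : t ≤ r) :
    powQuotMap a h' ≫ powQuotMap a h = powQuotMap a (h.trans h') := by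
  ext
  rfl

/-- The transition maps of the direct system `t ↦ Ext(R ⧸ a ^ t, M)`. -/
def extPowMap (a : Ideal R) (i : ℕ) (M : ModuleCat.{u} R) (s t : ℕ) (h : s ≤ t) :
    Abelian.Ext.{u} (powQuot a s) M i →ₗ[R] Abelian.Ext.{u} (powQuot a t) M i :=
  (Ext.mk₀ (powQuotMap a h)).precompOfLinear R M (zero_add i)

lemma extPowMap_apply (a : Ideal R) (i : ℕ) (M : ModuleCat.{u} R) {s t : ℕ} (h : s ≤ t)
    (x : Abelian.Ext.{u} (powQuot a s) M i) :
    extPowMap a i M s t h x = (Ext.mk₀ (powQuotMap a h)).comp x (zero_add i) := rfl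

instance (a : Ideal R) (i : ℕ) (M : ModuleCat.{u} R) :
    DirectedSystem (fun t => Abelian.Ext.{u} (powQuot a t) M i)
      (fun s t h => extPowMap a i M s t h) where
  map_self t x := by simp [extPowMap_apply, powQuotMap_self]
  map_map r s t h h' x := by
    simp only [extPowMap_apply, Ext.mk₀_comp_mk₀_assoc, powQuotMap_comp]

/-- The direct limit of the modules `Ext(R ⧸ a ^ t, M)`. -/
abbrev ExtLimit (a : Ideal R) (i : ℕ) (M : ModuleCat.{u} R) : Type u :=
  Module.DirectLimit (fun t => Abelian.Ext.{u} (powQuot a t) M i) (extPowMap a i M)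

/-- The canonical map from `Ext(R ⧸ a ^ t, M)` to the direct limit. -/
abbrev ExtLimit.of (a : Ideal R) (i : ℕ) (M : ModuleCat.{u} R) (t : ℕ) :
    Abelian.Ext.{u} (powQuot a t) M i →ₗ[R] ExtLimit a i M :=
  Module.DirectLimit.of R ℕ (fun t => Abelian.Ext.{u} (powQuot a t) M i) (extPowMap a i M) t

lemma ExtLimit.exists_of {a : Ideal R} {i : ℕ} {M : ModuleCat.{u} R} (x : ExtLimit a i M) :
    ∃ t y, ExtLimit.of a i M t y = x :=
  Module.DirectLimit.exists_of x

lemma ExtLimit.of_eq_zero_iff {a : Ideal R} {i : ℕ} {M : ModuleCat.{u} R} {t : ℕ}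
    {x : Abelian.Ext.{u} (powQuot a t) M i} :
    ExtLimit.of a i M t x = 0 ↔ ∃ s, ∃ h : t ≤ s, extPowMap a i M t s h x = 0 := by
  refine ⟨fun hx => ?_, fun ⟨s, h, hx⟩ => ?_⟩
  · exact Module.DirectLimit.of.zero_exact hx
  · rw [← Module.DirectLimit.of_f (hij := h), hx, map_zero]

lemma ExtLimit.of_extPowMap {a : Ideal R} {i : ℕ} {M : ModuleCat.{u} R} {t s : ℕ} (h : t ≤ s)
    (x : Abelian.Ext.{u} (powQuot a t) M i) :
    ExtLimit.of a i M s (extPowMap a i M t s h x) = ExtLimit.of a i M t x :=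
  Module.DirectLimit.of_f

open Limits in
lemma nonempty_directLimit_equiv_colimit {G : ℕ → Type u} [∀ t, AddCommGroup (G t)]
    [∀ t, Module R (G t)] (f : ∀ s t, s ≤ t → G s →ₗ[R] G t)
    [DirectedSystem G (fun s t h => f s t h)] (F : ℕᵒᵖᵒᵖ ⥤ ModuleCat.{u} R)
    (j : ∀ t, F.obj (op (op t)) ≅ ModuleCat.of R (G t))
    (hj : ∀ s t (h : s ≤ t), F.map (homOfLE h).op.op ≫ (j t).hom =
      (j s).hom ≫ ModuleCat.ofHom (f s t h)) :
    Nonempty (Module.DirectLimit G f ≃ₗ[R] (colimit F : ModuleCat.{u} R)) := by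
  have : IsFiltered ℕᵒᵖᵒᵖ := IsFiltered.of_equivalence (opOpEquivalence ℕ).symm
  have : PreservesFilteredColimitsOfSize.{0, 0} (forget (ModuleCat.{u} R)) :=
    preservesFilteredColimitsOfSize_shrink.{0, u, 0, u} _
  have hj' {s t : ℕ} (h : s ≤ t) : ModuleCat.ofHom (f s t h) ≫ (j t).inv =
      (j s).inv ≫ F.map (homOfLE h).op.op := by
    rw [Iso.comp_inv_eq, Category.assoc, hj _ _ h, Iso.inv_hom_id_assoc]
  let l : Module.DirectLimit G f →ₗ[R] (colimit F : ModuleCat.{u} R) :=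
    Module.DirectLimit.lift R ℕ _ _ (fun t => ((j t).inv ≫ colimit.ι F (op (op t))).hom) (by
      intro s t h x
      have := congrArg (· ≫ colimit.ι F (op (op t))) (hj' h)
      simp only [Category.assoc, colimit.w] at this
      exact ConcreteCategory.congr_hom this x)
  have hl (t x) : l (Module.DirectLimit.of R ℕ G f t x) =
      colimit.ι F (op (op t)) ((j t).inv x) :=
    Module.DirectLimit.lift_of _ _ _
  refine ⟨LinearEquiv.ofBijective l ⟨?_, fun x => ?_⟩⟩
  · refine (injective_iff_map_eq_zero _).2 fun x hx => ?_
    obtain ⟨t, y, rfl⟩ := Module.DirectLimit.exists_of x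
    rw [hl, ← map_zero (colimit.ι F (op (op t))).hom] at hx
    obtain ⟨k, p, q, hpq⟩ := (Concrete.colimit_rep_eq_iff_exists F _ _).1 hx
    have hle : t ≤ k.unop.unop := p.unop.unop.le
    have h1 := ConcreteCategory.congr_hom (hj' hle) y
    have h2 : F.map (homOfLE hle).op.op ((j t).inv y) = 0 := hpq.trans (map_zero _)
    have h3 : f t k.unop.unop hle y = 0 := by
      have hinj : Function.Injective (j k.unop.unop).inv :=
        (ModuleCat.mono_iff_injective _).1 inferInstance
      exact hinj ((h1.trans h2).trans (map_zero _).symm)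
    rw [← Module.DirectLimit.of_f (hij := hle), h3, map_zero]
  · obtain ⟨t, y, rfl⟩ := Concrete.colimit_exists_rep F x
    refine ⟨Module.DirectLimit.of R ℕ G f t.unop.unop ((j t.unop.unop).hom y),
      (hl _ _).trans ?_⟩
    exact congrArg (colimit.ι F t) (Iso.hom_inv_id_apply (j t.unop.unop) y)

/-- The direct system whose colimit computes local cohomology. -/
abbrev extPowDiagram (a : Ideal R) (i : ℕ) (M : ModuleCat.{u} R) : ℕᵒᵖᵒᵖ ⥤ ModuleCat.{u} R :=
  localCohomology.diagram (localCohomology.idealPowersDiagram a) i ⋙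
    (evaluation (ModuleCat.{u} R) (ModuleCat.{u} R)).obj M

open Limits in
lemma nonempty_localCohomology_iso_colimit (a : Ideal R) (i : ℕ) (M : ModuleCat.{u} R) :
    Nonempty ((localCohomology a i).obj M ≅ colimit (extPowDiagram a i M)) :=
  ⟨colimitObjIsoColimitCompEvaluation
    (localCohomology.diagram (localCohomology.idealPowersDiagram a) i) M⟩

lemma extPowDiagram_naturality (a : Ideal R) (i : ℕ) (M : ModuleCat.{u} R) (s t : ℕ)
    (h : s ≤ t) : (extPowDiagram a i M).map (homOfLE h).op.op ≫
      (leftDerivedExtIso (powQuot a t) M i).hom =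
        (leftDerivedExtIso (powQuot a s) M i).hom ≫ ModuleCat.ofHom (extPowMap a i M s t h) :=
  leftDerivedExtIso_naturality (powQuotMap a h) M i

open Limits in
/-- Local cohomology is the direct limit of the modules `Ext(R ⧸ a ^ t, M)`. -/
lemma nonempty_extLimit_equiv_localCohomology (a : Ideal R) (i : ℕ) (M : ModuleCat.{u} R) :
    Nonempty (ExtLimit a i M ≃ₗ[R] (localCohomology a i).obj M) := by
  obtain ⟨e⟩ := nonempty_localCohomology_iso_colimit a i M
  obtain ⟨e'⟩ := nonempty_directLimit_equiv_colimit (extPowMap a i M) (extPowDiagram a i M)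
    (fun t => leftDerivedExtIso (powQuot a t) M i) (extPowDiagram_naturality a i M)
  exact ⟨e'.trans e.symm.toLinearEquiv⟩

namespace IsSerreClass

variable {S : ModuleCat.{u} R → Prop} {A B C : Type u} [AddCommGroup A] [AddCommGroup B]
  [AddCommGroup C] [Module R A] [Module R B] [Module R C]

lemma of_equiv (hS : IsSerreClass S) (e : A ≃ₗ[R] B) (hA : S (ModuleCat.of R A)) :
    S (ModuleCat.of R B) :=
  hS.iso (M := ModuleCat.of R A) (N := ModuleCat.of R B) e hA

lemma of_injective (hS : IsSerreClass S) (f : A →ₗ[R] B) (hf : Function.Injective f)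
    (hB : S (ModuleCat.of R B)) : S (ModuleCat.of R A) :=
  hS.of_equiv (LinearEquiv.ofInjective f hf).symm (hS.subobj _ (LinearMap.range f) hB)

lemma of_surjective (hS : IsSerreClass S) (f : A →ₗ[R] B) (hf : Function.Surjective f)
    (hA : S (ModuleCat.of R A)) : S (ModuleCat.of R B) :=
  have h : S (ModuleCat.of R (A ⧸ LinearMap.ker f)) :=
    hS.quot (ModuleCat.of R A) (LinearMap.ker f) hA
  hS.of_equiv (f.quotKerEquivOfSurjective hf) h

lemma of_exact (hS : IsSerreClass S) (f : A →ₗ[R] B) (g : B →ₗ[R] C)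
    (hfg : LinearMap.ker g ≤ LinearMap.range f) (hA : S (ModuleCat.of R A))
    (hC : S (ModuleCat.of R C)) : S (ModuleCat.of R B) := by
  refine hS.extension (ModuleCat.of R B) (LinearMap.ker g) ?_ ?_
  · exact hS.of_injective (Submodule.inclusion hfg) (Submodule.inclusion_injective hfg)
      (hS.of_surjective f.rangeRestrict f.surjective_rangeRestrict hA)
  · exact hS.of_equiv g.quotKerEquivRange.symm (hS.subobj _ (LinearMap.range g) hC)

lemma pi_fin (hS : IsSerreClass S) (hA : S (ModuleCat.of R A)) (n : ℕ) :
    S (ModuleCat.of R (Fin n → A)) := by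
  induction n with
  | zero => exact hS.zero _ (inferInstanceAs (Subsingleton (Fin 0 → A)))
  | succ n ih =>
    refine hS.of_exact (LinearMap.single R (fun _ : Fin (n + 1) => A) 0)
      (LinearMap.funLeft R A Fin.succ) (fun x hx => ⟨x 0, ?_⟩) hA ih
    ext k
    refine Fin.cases (by simp) (fun k => ?_) k
    simpa using (congrFun hx k).symm

end IsSerreClass

/-- The short complex of `R`-modules `0 → ker f → A → B → 0`. -/
lemma shortExact_ker {A B : ModuleCat.{u} R} (f : A ⟶ B) (hf : Function.Surjective f) :
    (ShortComplex.mk (ModuleCat.ofHom (LinearMap.ker f.hom).subtype) f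
      (by ext x; exact x.2)).ShortExact where
  exact := (ShortComplex.moduleCat_exact_iff _).2 fun x hx => ⟨⟨x, hx⟩, rfl⟩
  mono_f := (ModuleCat.mono_iff_injective _).2 Subtype.val_injective
  epi_g := (ModuleCat.epi_iff_surjective _).2 hf

lemma IsSerreClass.ext_mem [IsNoetherianRing R] {S : ModuleCat.{u} R → Prop}
    (hS : IsSerreClass S) {M : ModuleCat.{u} R} (hM : S M) (j : ℕ) (X : ModuleCat.{u} R)
    [Module.Finite R X] : S (ModuleCat.of R (Abelian.Ext.{u} X M j)) := by
  induction j generalizing X with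
  | zero =>
    obtain ⟨n, f, hf⟩ := Module.Finite.exists_fin' R X
    have : Epi (ModuleCat.ofHom f) := (ModuleCat.epi_iff_surjective _).2 hf
    refine hS.of_injective ((Ext.mk₀ (ModuleCat.ofHom f)).precompOfLinear R M (zero_add 0))
      (Ext.precomp_mk₀_injective_of_epi M (ModuleCat.ofHom f)) ?_
    refine hS.of_equiv (Ext.linearEquiv₀ (R := R)).symm ?_
    refine hS.of_equiv (ModuleCat.homLinearEquiv (S := R)).symm ?_
    exact hS.of_equiv ((Pi.basisFun R (Fin n)).constr R) (hS.pi_fin hM n)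
  | succ j ih =>
    obtain ⟨n, f, hf⟩ := Module.Finite.exists_fin' R X
    have hex := shortExact_ker (ModuleCat.ofHom f) hf
    refine hS.of_surjective (hex.extClass.precompOfLinear R M (add_comm 1 j)) (fun x => ?_)
      (ih (ModuleCat.of R (LinearMap.ker f)))
    have : Projective (ModuleCat.of R (Fin n → R)) := inferInstance
    exact Ext.contravariant_sequence_exact₃ hex M x (Ext.eq_zero_of_projective _) (add_comm 1 j)

namespace ExtLimit

variable (a : Ideal R)

/-- The map on direct limits induced by composition with an extension class. -/
def comp {Y Z : ModuleCat.{u} R} {i b j : ℕ} (β : Abelian.Ext.{u} Y Z b) (h : i + b = j) :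
    ExtLimit a i Y →ₗ[R] ExtLimit a j Z :=
  Module.DirectLimit.map (fun t => β.postcompOfLinear R (powQuot a t) h) (by
    intro s t hst
    ext x
    exact Ext.comp_assoc _ _ _ (zero_add _) h (by omega))

lemma comp_of {Y Z : ModuleCat.{u} R} {i b j : ℕ} (β : Abelian.Ext.{u} Y Z b) (h : i + b = j)
    {t : ℕ} (x : Abelian.Ext.{u} (powQuot a t) Y i) :
    comp a β h (ExtLimit.of a i Y t x) = ExtLimit.of a j Z t (x.comp β h) :=
  Module.DirectLimit.map_apply_of _ _ _

variable {a} {T : ShortComplex (ModuleCat.{u} R)} (hT : T.ShortExact)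

lemma exact₁ {i j : ℕ} (h : i + 1 = j) (x : ExtLimit a j T.X₁)
    (hx : comp a (Ext.mk₀ T.f) (add_zero j) x = 0) : ∃ y, comp a hT.extClass h y = x := by
  obtain ⟨t, x, rfl⟩ := exists_of x
  rw [comp_of, of_eq_zero_iff] at hx
  obtain ⟨s, hs, hx⟩ := hx
  obtain ⟨y, hy⟩ := Ext.covariant_sequence_exact₁ _ hT (extPowMap a j T.X₁ t s hs x)
    ((Ext.comp_assoc _ _ _ (zero_add _) _ (by omega)).trans hx) h
  exact ⟨of a i _ s y, by rw [comp_of, hy, of_extPowMap]⟩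

include hT in
lemma exact₂ {i : ℕ} (x : ExtLimit a i T.X₂)
    (hx : comp a (Ext.mk₀ T.g) (add_zero i) x = 0) :
    ∃ y, comp a (Ext.mk₀ T.f) (add_zero i) y = x := by
  obtain ⟨t, x, rfl⟩ := exists_of x
  rw [comp_of, of_eq_zero_iff] at hx
  obtain ⟨s, hs, hx⟩ := hx
  obtain ⟨y, hy⟩ := Ext.covariant_sequence_exact₂ _ hT (extPowMap a i T.X₂ t s hs x)
    ((Ext.comp_assoc _ _ _ (zero_add _) _ (by omega)).trans hx)
  exact ⟨of a i _ s y, by rw [comp_of, hy, of_extPowMap]⟩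

lemma eq_zero_of_injective {E : ModuleCat.{u} R} [Injective E] {i : ℕ}
    (x : ExtLimit a (i + 1) E) : x = 0 := by
  obtain ⟨t, x, rfl⟩ := exists_of x
  rw [x.eq_zero_of_injective, map_zero]

end ExtLimit

lemma mem_torsionGamma {a : Ideal R} {M : Type u} [AddCommGroup M] [Module R M] {x : M} :
    x ∈ torsionGamma a M ↔ ∃ n : ℕ, ∀ r ∈ a ^ n, r • x = 0 := by
  have hmono : Monotone fun n : ℕ => torsionBySet R M ((a ^ n : Ideal R) : Set R) :=
    fun m n h => torsionBySet_le_torsionBySet_of_subset (Ideal.pow_le_pow_right h)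
  rw [torsionGamma, Submodule.mem_iSup_of_directed _ hmono.directed_le]
  simp [Submodule.mem_torsionBySet_iff]

/-- Evaluation at `1` of the homomorphism `R ⧸ a ^ t ⟶ M` corresponding to a class in `Ext⁰`. -/
def extZeroEval (a : Ideal R) (M : ModuleCat.{u} R) (t : ℕ) :
    Abelian.Ext.{u} (powQuot a t) M 0 →ₗ[R] M :=
  LinearMap.applyₗ (1 : R ⧸ a ^ t) ∘ₗ (ModuleCat.homLinearEquiv (S := R)).toLinearMap ∘ₗ
    (Ext.linearEquiv₀ (R := R)).toLinearMap

lemma extZeroEval_mk₀ (a : Ideal R) (M : ModuleCat.{u} R) (t : ℕ) (f : powQuot a t ⟶ M) :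
    extZeroEval a M t (Ext.mk₀ f) = f.hom (1 : R ⧸ a ^ t) := by
  have : Ext.linearEquiv₀ (R := R) (Ext.mk₀ f) = f :=
    (Ext.linearEquiv₀ (R := R)).symm_apply_eq.1 rfl |>.symm
  simp only [extZeroEval, LinearMap.comp_apply, LinearEquiv.coe_coe, this]
  rfl

lemma extZeroEval_extPowMap (a : Ideal R) (M : ModuleCat.{u} R) {s t : ℕ} (h : s ≤ t)
    (x : Abelian.Ext.{u} (powQuot a s) M 0) :
    extZeroEval a M t (extPowMap a 0 M s t h x) = extZeroEval a M s x := by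
  obtain ⟨f, rfl⟩ := Ext.mk₀_bijective _ _ |>.2 x
  rw [extPowMap_apply, Ext.mk₀_comp_mk₀, extZeroEval_mk₀, extZeroEval_mk₀]
  rfl

lemma extZeroEval_injective (a : Ideal R) (M : ModuleCat.{u} R) (t : ℕ) :
    Function.Injective (extZeroEval a M t) := by
  refine (injective_iff_map_eq_zero _).2 fun x hx => ?_
  obtain ⟨f, rfl⟩ := Ext.mk₀_bijective _ _ |>.2 x
  rw [extZeroEval_mk₀] at hx
  have : f = 0 := by
    ext
    exact hx
  rw [this, Ext.mk₀_zero]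

lemma smul_extZeroEval (a : Ideal R) (M : ModuleCat.{u} R) (t : ℕ)
    (x : Abelian.Ext.{u} (powQuot a t) M 0) {r : R} (hr : r ∈ a ^ t) :
    r • extZeroEval a M t x = 0 := by
  obtain ⟨f, rfl⟩ := Ext.mk₀_bijective _ _ |>.2 x
  rw [extZeroEval_mk₀, ← map_smul, ← map_zero f.hom]
  congr 1
  exact (Submodule.Quotient.mk_eq_zero (a ^ t)).2 (by simpa using hr)

lemma exists_extZeroEval_eq (a : Ideal R) (M : ModuleCat.{u} R) (t : ℕ) (m : M)
    (hm : ∀ r ∈ a ^ t, r • m = 0) : ∃ x, extZeroEval a M t x = m := by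
  refine ⟨Ext.mk₀ (ModuleCat.ofHom ((a ^ t).liftQ (LinearMap.toSpanSingleton R M m) ?_)), ?_⟩
  · intro r hr
    exact hm r hr
  · rw [extZeroEval_mk₀]
    exact one_smul R m

/-- The evaluation map from the direct limit of `Hom(R ⧸ a ^ t, M)` to `M`. -/
def ExtLimit.eval (a : Ideal R) (M : ModuleCat.{u} R) : ExtLimit a 0 M →ₗ[R] M :=
  Module.DirectLimit.lift R ℕ _ _ (extZeroEval a M) fun _ _ => extZeroEval_extPowMap a M

lemma ExtLimit.eval_of (a : Ideal R) (M : ModuleCat.{u} R) (t : ℕ)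
    (x : Abelian.Ext.{u} (powQuot a t) M 0) :
    ExtLimit.eval a M (ExtLimit.of a 0 M t x) = extZeroEval a M t x :=
  Module.DirectLimit.lift_of _ _ _

lemma ExtLimit.eval_injective (a : Ideal R) (M : ModuleCat.{u} R) :
    Function.Injective (ExtLimit.eval a M) :=
  Module.DirectLimit.lift_injective _ _ (extZeroEval_injective a M)

lemma ExtLimit.mem_range_eval (a : Ideal R) (M : ModuleCat.{u} R) (m : M) :
    m ∈ LinearMap.range (ExtLimit.eval a M) ↔ m ∈ torsionGamma a M := by
  rw [mem_torsionGamma]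
  constructor
  · rintro ⟨x, rfl⟩
    obtain ⟨t, x, rfl⟩ := ExtLimit.exists_of x
    exact ⟨t, fun r hr => by rw [ExtLimit.eval_of, smul_extZeroEval a M t x hr]⟩
  · rintro ⟨t, ht⟩
    obtain ⟨x, hx⟩ := exists_extZeroEval_eq a M t m ht
    exact ⟨_, (ExtLimit.eval_of a M t x).trans hx⟩

lemma ExtLimit.eval_comp (a : Ideal R) {M N : ModuleCat.{u} R} (g : M ⟶ N)
    (x : ExtLimit a 0 M) :
    ExtLimit.eval a N (ExtLimit.comp a (Ext.mk₀ g) (add_zero 0) x) =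
      g (ExtLimit.eval a M x) := by
  obtain ⟨t, x, rfl⟩ := ExtLimit.exists_of x
  obtain ⟨f, rfl⟩ := Ext.mk₀_bijective _ _ |>.2 x
  rw [ExtLimit.comp_of, ExtLimit.eval_of, ExtLimit.eval_of, Ext.mk₀_comp_mk₀, extZeroEval_mk₀,
    extZeroEval_mk₀]
  rfl

section torsionGamma

variable {M N : Type u} [AddCommGroup M] [Module R M] [AddCommGroup N] [Module R N]

lemma map_mem_torsionGamma {a : Ideal R} (f : M →ₗ[R] N) {x : M} (hx : x ∈ torsionGamma a M) :
    f x ∈ torsionGamma a N := by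
  obtain ⟨n, hn⟩ := mem_torsionGamma.1 hx
  exact mem_torsionGamma.2 ⟨n, fun r hr => by rw [← map_smul, hn r hr, map_zero]⟩

lemma mem_torsionGamma_of_injective {a : Ideal R} (f : M →ₗ[R] N) (hf : Function.Injective f)
    {x : M} (hx : f x ∈ torsionGamma a N) : x ∈ torsionGamma a M := by
  obtain ⟨n, hn⟩ := mem_torsionGamma.1 hx
  exact mem_torsionGamma.2 ⟨n, fun r hr => hf (by rw [map_smul, hn r hr, map_zero])⟩

lemma torsionGamma_torsionGamma (a : Ideal R) : torsionGamma a (torsionGamma a M) = ⊤ :=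
  eq_top_iff.2 fun x _ =>
    mem_torsionGamma_of_injective (torsionGamma a M).subtype Subtype.val_injective x.2

lemma torsionGamma_eq_top_of_surjective {a : Ideal R} (f : M →ₗ[R] N) (hf : Function.Surjective f)
    (h : torsionGamma a M = ⊤) : torsionGamma a N = ⊤ := by
  refine eq_top_iff.2 fun y _ => ?_
  obtain ⟨x, rfl⟩ := hf y
  exact map_mem_torsionGamma f (h ▸ mem_top)

lemma exists_pow_smul_eq_zero {a : Ideal R} [IsNoetherian R N] (f : N →ₗ[R] M)
    (hf : ∀ x, f x ∈ torsionGamma a M) : ∃ n : ℕ, ∀ x, ∀ r ∈ a ^ n, r • f x = 0 := by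
  let c : ℕ →o Submodule R N :=
    ⟨fun n => (torsionBySet R M ((a ^ n : Ideal R) : Set R)).comap f, fun m n h =>
      comap_mono (torsionBySet_le_torsionBySet_of_subset (Ideal.pow_le_pow_right h))⟩
  have hc (n : ℕ) (x : N) : x ∈ c n ↔ ∀ r ∈ a ^ n, r • f x = 0 := by
    exact Submodule.mem_comap.trans (by simp [Submodule.mem_torsionBySet_iff])
  obtain ⟨n, hn⟩ := monotone_stabilizes_iff_noetherian.2 ‹_› c
  refine ⟨n, fun x => ?_⟩
  obtain ⟨k, hk⟩ := mem_torsionGamma.1 (hf x)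
  rw [← hc, hn _ (le_max_left n k)]
  exact c.monotone (le_max_right n k) ((hc k x).2 hk)

variable [IsNoetherianRing R]

lemma torsionGamma_quotient_torsionGamma (a : Ideal R) :
    torsionGamma a (M ⧸ torsionGamma a M) = ⊥ := by
  refine eq_bot_iff.2 fun q hq => ?_
  obtain ⟨m, rfl⟩ := Submodule.Quotient.mk_surjective _ q
  obtain ⟨n, hn⟩ := mem_torsionGamma.1 hq
  obtain ⟨k, hk⟩ := exists_pow_smul_eq_zero (a := a)
    (LinearMap.toSpanSingleton R M m ∘ₗ (a ^ n).subtype)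
    (fun r => (Submodule.Quotient.mk_eq_zero _).1 (hn r.1 r.2))
  refine (Submodule.Quotient.mk_eq_zero _).2 (mem_torsionGamma.2 ⟨k + n, fun r hr => ?_⟩)
  rw [pow_add] at hr
  refine Submodule.mul_induction_on hr (fun s hs t ht => ?_) fun s t hs ht => ?_
  · rw [mul_smul]
    exact hk ⟨t, ht⟩ s hs
  · rw [add_smul, hs, ht, add_zero]

/-- Over a noetherian ring, the torsion submodule of an injective module is injective. -/
lemma injective_torsionGamma (a : Ideal R) (E : Type u) [AddCommGroup E] [Module R E]
    [Module.Injective R E] : Module.Injective R (torsionGamma a E) := by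
  refine Module.Baer.injective fun b g => ?_
  obtain ⟨n, hn⟩ := exists_pow_smul_eq_zero (a := a) ((torsionGamma a E).subtype ∘ₗ g)
    fun x => (g x).2
  obtain ⟨k, hk⟩ := a.exists_pow_inf_eq_pow_smul b
  have hker (x : b) (hx : (x : R) ∈ a ^ (n + k)) : g x = 0 := by
    have hx' : (x : R) ∈ a ^ n • b := by
      have : (x : R) ∈ a ^ (n + k) • (⊤ : Submodule R R) ⊓ b := ⟨by simpa using hx, x.2⟩
      rw [hk _ (Nat.le_add_left k n), Nat.add_sub_cancel] at this
      exact (smul_mono_right (a ^ n) (inf_le_right : _ ⊓ b ≤ b) : _) this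
    have : ∃ h, g ⟨x, h⟩ = 0 := by
      refine Submodule.smul_induction_on (p := fun y => ∃ h, g ⟨y, h⟩ = 0) hx'
        (fun r hr y hy => ⟨b.smul_mem r hy, ?_⟩) ?_
      · exact Subtype.ext ((congrArg Subtype.val (g.map_smul r ⟨y, hy⟩)).trans (hn ⟨y, hy⟩ r hr))
      · rintro y z ⟨hy, hgy⟩ ⟨hz, hgz⟩
        exact ⟨b.add_mem hy hz, (g.map_add ⟨y, hy⟩ ⟨z, hz⟩).trans (by rw [hgy, hgz, add_zero])⟩
    exact this.2
  let i : b →ₗ[R] R ⧸ a ^ (n + k) := (a ^ (n + k)).mkQ ∘ₗ b.subtype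
  have hi : LinearMap.ker i ≤ LinearMap.ker ((torsionGamma a E).subtype ∘ₗ g) := fun x hx =>
    congrArg Subtype.val (hker x ((Submodule.Quotient.mk_eq_zero _).1 hx))
  obtain ⟨h, hh⟩ := Module.Injective.out ((LinearMap.ker i).liftQ i le_rfl)
    (LinearMap.ker_eq_bot.1 (Submodule.ker_liftQ_eq_bot' _ _ rfl))
    ((LinearMap.ker i).liftQ _ hi)
  refine ⟨(h ∘ₗ (a ^ (n + k)).mkQ).codRestrict _ fun r => ?_, fun x hx => Subtype.ext ?_⟩
  · refine mem_torsionGamma.2 ⟨n + k, fun s hs => ?_⟩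
    rw [← map_smul]
    exact (congrArg h ((Submodule.Quotient.mk_eq_zero _).2
      ((a ^ (n + k)).mul_mem_right r hs))).trans (map_zero h)
  · exact hh (Submodule.Quotient.mk ⟨x, hx⟩)

lemma injective_quotient_torsionGamma (a : Ideal R) (E : Type u) [AddCommGroup E] [Module R E]
    [Module.Injective R E] : Module.Injective R (E ⧸ torsionGamma a E) := by
  have := injective_torsionGamma a E
  obtain ⟨p, hp⟩ := Module.Injective.out (R := R) (torsionGamma a E).subtype
    Subtype.val_injective LinearMap.id
  let s : E ⧸ torsionGamma a E →ₗ[R] E :=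
    (torsionGamma a E).liftQ (LinearMap.id - (torsionGamma a E).subtype ∘ₗ p) fun x hx =>
      LinearMap.mem_ker.2 (sub_eq_zero.2 (congrArg Subtype.val (hp ⟨x, hx⟩)).symm)
  have hs (x) : (torsionGamma a E).mkQ (s x) = x := by
    obtain ⟨x, rfl⟩ := Submodule.Quotient.mk_surjective _ x
    refine (Submodule.Quotient.eq _).2 ?_
    change (x - (p x : E)) - x ∈ _
    simp
  refine Module.Baer.injective fun b g => ?_
  obtain ⟨h, hh⟩ := Module.Injective.out b.subtype Subtype.val_injective (s ∘ₗ g)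
  exact ⟨(torsionGamma a E).mkQ ∘ₗ h, fun x hx =>
    (congrArg _ (hh ⟨x, hx⟩)).trans (hs _)⟩

end torsionGamma

/-- The short complex `0 → N → M → M ⧸ N → 0`. -/
lemma shortExact_mkQ {M : Type u} [AddCommGroup M] [Module R M] (N : Submodule R M) :
    (ModuleCat.shortComplexOfCompEqZero N.subtype N.mkQ
      (LinearMap.ext fun x => (Submodule.Quotient.mk_eq_zero N).2 x.2)).ShortExact :=
  ModuleCat.shortComplex_shortExact _ (LinearMap.exact_subtype_mkQ N) Subtype.val_injective
    N.mkQ_surjective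

/-- The short complex `0 → M → E → E ⧸ M → 0` attached to an injective map `M → E`. -/
lemma shortExact_range_mkQ {M E : Type u} [AddCommGroup M] [Module R M] [AddCommGroup E]
    [Module R E] (f : M →ₗ[R] E) (hf : Function.Injective f) :
    (ModuleCat.shortComplexOfCompEqZero f (LinearMap.range f).mkQ
      (LinearMap.range_mkQ_comp f)).ShortExact :=
  ModuleCat.shortComplex_shortExact _ (LinearMap.exact_map_mkQ_range f) hf
    (LinearMap.range f).mkQ_surjective

lemma exists_injective_linearMap_injective (M : ModuleCat.{u} R) :
    ∃ (E : ModuleCat.{u} R) (f : M →ₗ[R] E), Function.Injective f ∧ Module.Injective R E :=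
  ⟨Injective.under M, (Injective.ι M).hom, (ModuleCat.mono_iff_injective _).1 inferInstance,
    Module.injective_module_of_injective_object R _
      (inj := inferInstanceAs (Injective (Injective.under M)))⟩

lemma exists_torsion_injective [IsNoetherianRing R] {a : Ideal R} {N : ModuleCat.{u} R}
    (hN : torsionGamma a N = ⊤) : ∃ (E : ModuleCat.{u} R) (f : N →ₗ[R] E),
      Function.Injective f ∧ Injective E ∧ torsionGamma a E = ⊤ := by
  obtain ⟨E, f, hf, hE⟩ := exists_injective_linearMap_injective N
  have := injective_torsionGamma a E
  exact ⟨ModuleCat.of R (torsionGamma a E),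
    f.codRestrict _ fun x => map_mem_torsionGamma f (hN ▸ mem_top),
    LinearMap.injective_codRestrict_iff .. |>.2 hf,
    Module.injective_object_of_injective_module R _, torsionGamma_torsionGamma a⟩

namespace ExtLimit

variable {a : Ideal R}

lemma comp_extClass_comp_g {T : ShortComplex (ModuleCat.{u} R)} (hT : T.ShortExact) {i j : ℕ}
    (h : i + 1 = j) (x : ExtLimit a i T.X₂) :
    comp a hT.extClass h (comp a (Ext.mk₀ T.g) (add_zero i) x) = 0 := by
  obtain ⟨t, x, rfl⟩ := exists_of x
  rw [comp_of, comp_of, Ext.comp_assoc x (Ext.mk₀ T.g) hT.extClass (add_zero i) (zero_add 1)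
    (by omega), hT.comp_extClass, Ext.comp_zero, map_zero]

lemma exists_comp_eq_of_surjective {M N : ModuleCat.{u} R} (hM : torsionGamma a M = ⊤)
    (g : M ⟶ N) (hg : Function.Surjective g) (y : ExtLimit a 0 N) :
    ∃ x, comp a (Ext.mk₀ g) (add_zero 0) x = y := by
  obtain ⟨m, hm⟩ := hg (eval a N y)
  obtain ⟨x, hx⟩ := (mem_range_eval a M m).2 (hM ▸ mem_top)
  exact ⟨x, eval_injective a N (by rw [eval_comp, hx, hm])⟩

lemma eq_zero_of_torsion [IsNoetherianRing R] {i : ℕ} {N : ModuleCat.{u} R}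
    (hN : torsionGamma a N = ⊤) (x : ExtLimit a (i + 1) N) : x = 0 := by
  induction i generalizing N with
  | zero =>
    obtain ⟨E, f, hf, _, hE⟩ := exists_torsion_injective hN
    have hT := shortExact_range_mkQ f hf
    obtain ⟨y, rfl⟩ := exact₁ hT rfl x (eq_zero_of_injective _)
    obtain ⟨z, rfl⟩ := exists_comp_eq_of_surjective hE _ hT.moduleCat_surjective_g y
    exact comp_extClass_comp_g hT rfl z
  | succ i ih =>
    obtain ⟨E, f, hf, _, hE⟩ := exists_torsion_injective hN
    obtain ⟨y, rfl⟩ := exact₁ (shortExact_range_mkQ f hf) rfl x (eq_zero_of_injective _)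
    have hQ := torsionGamma_eq_top_of_surjective (a := a) (LinearMap.range f).mkQ
      (LinearMap.range f).mkQ_surjective hE
    exact (congrArg _ (ih hQ y)).trans (map_zero _)

end ExtLimit

variable {a : Ideal R}

lemma IsSerreClass.torsionGamma_mem {S : ModuleCat.{u} R → Prop} (hS : IsSerreClass S)
    (hC : CCond S a) {M : ModuleCat.{u} R}
    (hM : S (ModuleCat.of R (Abelian.Ext.{u} (powQuot a 1) M 0))) :
    S (ModuleCat.of R (torsionGamma a M)) := by
  refine hC (ModuleCat.of R (torsionGamma a M)) (torsionGamma_torsionGamma a) ?_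
  have h := hS.of_surjective (extZeroEval a M 1).rangeRestrict
    (extZeroEval a M 1).surjective_rangeRestrict hM
  have hmem (x : torsionBySet R (torsionGamma a M) (a : Set R)) :
      (x : torsionGamma a M).1 ∈ LinearMap.range (extZeroEval a M 1) := by
    refine exists_extZeroEval_eq a M 1 _ fun r hr => ?_
    exact congrArg Subtype.val ((mem_torsionBySet_iff _ _).1 x.2 ⟨r, by simpa using hr⟩)
  exact hS.of_injective
    (((torsionGamma a M).subtype ∘ₗ Submodule.subtype _).codRestrict _ hmem)
    (LinearMap.injective_codRestrict_iff .. |>.2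
      (Subtype.val_injective.comp Subtype.val_injective)) h

lemma IsSerreClass.extLimit_zero_mem {S : ModuleCat.{u} R → Prop} (hS : IsSerreClass S)
    {M : ModuleCat.{u} R} (hM : S (ModuleCat.of R (torsionGamma a M))) :
    S (ModuleCat.of R (ExtLimit a 0 M)) :=
  hS.of_injective ((ExtLimit.eval a M).codRestrict (torsionGamma a M)
      fun x => (ExtLimit.mem_range_eval a M _).1 ⟨x, rfl⟩)
    (LinearMap.injective_codRestrict_iff .. |>.2 (ExtLimit.eval_injective a M)) hM

/-- `Ext(R ⧸ a, -)` vanishes on injective modules without `a`-torsion. -/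
lemma ext_powQuot_one_eq_zero {E : ModuleCat.{u} R} [Injective E]
    (hE : torsionGamma a E = ⊥) {j : ℕ} (x : Abelian.Ext.{u} (powQuot a 1) E j) : x = 0 := by
  cases j with
  | zero =>
    refine extZeroEval_injective a E 1 (.trans ?_ (map_zero _).symm)
    have : extZeroEval a E 1 x ∈ torsionGamma a E :=
      mem_torsionGamma.2 ⟨1, fun r hr => smul_extZeroEval a E 1 x hr⟩
    rwa [hE] at this
  | succ j => exact x.eq_zero_of_injective

variable [IsNoetherianRing R]

/-- Modules without `a`-torsion embed into injective modules without `a`-torsion. -/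
lemma exists_injective_torsionGamma_eq_bot {Q : ModuleCat.{u} R} (hQ : torsionGamma a Q = ⊥) :
    ∃ (E : ModuleCat.{u} R) (f : Q →ₗ[R] E),
      Function.Injective f ∧ Injective E ∧ torsionGamma a E = ⊥ := by
  obtain ⟨E, f, hf, hE⟩ := exists_injective_linearMap_injective Q
  have := injective_quotient_torsionGamma a E
  refine ⟨ModuleCat.of R (E ⧸ torsionGamma a E), (torsionGamma a E).mkQ ∘ₗ f, ?_,
    Module.injective_object_of_injective_module R _, torsionGamma_quotient_torsionGamma a⟩
  refine (injective_iff_map_eq_zero _).2 fun x hx => ?_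
  have : x ∈ torsionGamma a Q :=
    mem_torsionGamma_of_injective f hf ((Submodule.Quotient.mk_eq_zero _).1 hx)
  rwa [hQ] at this

/-- Dimension shifting for modules without `a`-torsion. -/
lemma exists_extLimit_succ_surjective {S : ModuleCat.{u} R → Prop} (hS : IsSerreClass S)
    {Q : ModuleCat.{u} R} (hQ : torsionGamma a Q = ⊥)
    (h : ∀ j, S (ModuleCat.of R (Abelian.Ext.{u} (powQuot a 1) Q j))) (i : ℕ) :
    ∃ N : ModuleCat.{u} R, (∀ j, S (ModuleCat.of R (Abelian.Ext.{u} (powQuot a 1) N j))) ∧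
      ∃ f : ExtLimit a i N →ₗ[R] ExtLimit a (i + 1) Q, Function.Surjective f := by
  obtain ⟨E, f, hf, _, hE⟩ := exists_injective_torsionGamma_eq_bot hQ
  have hT := shortExact_range_mkQ f hf
  refine ⟨ModuleCat.of R (E ⧸ LinearMap.range f), fun j => ?_,
    ExtLimit.comp a hT.extClass rfl,
    fun x => ExtLimit.exact₁ hT rfl x (ExtLimit.eq_zero_of_injective _)⟩
  refine hS.of_injective (hT.extClass.postcompOfLinear R (powQuot a 1) rfl)
    ((injective_iff_map_eq_zero _).2 fun x hx => ?_) (h (j + 1))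
  obtain ⟨y, rfl⟩ := Ext.covariant_sequence_exact₃ _ hT x rfl hx
  rw [ext_powQuot_one_eq_zero hE y, Ext.zero_comp]

lemma IsSerreClass.ext_quotient_torsionGamma_mem {S : ModuleCat.{u} R → Prop}
    (hS : IsSerreClass S) {M : ModuleCat.{u} R} (hK : S (ModuleCat.of R (torsionGamma a M)))
    (h : ∀ j, S (ModuleCat.of R (Abelian.Ext.{u} (powQuot a 1) M j))) (j : ℕ) :
    S (ModuleCat.of R (Abelian.Ext.{u} (powQuot a 1)
      (ModuleCat.of R (M ⧸ torsionGamma a M)) j)) := by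
  have hT := shortExact_mkQ (torsionGamma a M)
  refine hS.of_exact ((Ext.mk₀ (ModuleCat.ofHom (torsionGamma a M).mkQ)).postcompOfLinear R
      (powQuot a 1) (add_zero j)) (hT.extClass.postcompOfLinear R (powQuot a 1) rfl)
    (fun x hx => ?_) (h j) (hS.ext_mem hK (j + 1) (powQuot a 1))
  exact Ext.covariant_sequence_exact₃ _ hT x rfl hx

theorem IsSerreClass.extLimit_mem {S : ModuleCat.{u} R → Prop} (hS : IsSerreClass S)
    (hC : CCond S a) {M : ModuleCat.{u} R}
    (h : ∀ j, S (ModuleCat.of R (Abelian.Ext.{u} (powQuot a 1) M j))) (i : ℕ) :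
    S (ModuleCat.of R (ExtLimit a i M)) := by
  induction i generalizing M with
  | zero => exact hS.extLimit_zero_mem (hS.torsionGamma_mem hC (h 0))
  | succ i ih =>
    have hT := shortExact_mkQ (torsionGamma a M)
    obtain ⟨N, hN, f, hf⟩ := exists_extLimit_succ_surjective hS
      (Q := ModuleCat.of R (M ⧸ torsionGamma a M)) (torsionGamma_quotient_torsionGamma a)
      (hS.ext_quotient_torsionGamma_mem (hS.torsionGamma_mem hC (h 0)) h) i
    refine hS.of_injective
      (ExtLimit.comp a (Ext.mk₀ (ModuleCat.ofHom (torsionGamma a M).mkQ)) (add_zero (i + 1)))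
      ((injective_iff_map_eq_zero _).2 fun x hx => ?_) (hS.of_surjective f hf (ih hN))
    obtain ⟨y, rfl⟩ := ExtLimit.exact₂ hT x hx
    rw [ExtLimit.eq_zero_of_torsion (torsionGamma_torsionGamma a) y, map_zero]

end

/-- If a Serre subcategory `S` satisfies the `C_a` condition and `M ∈ S` is finitely
generated, then the local cohomology modules `H^i_a(M)` belong to `S` for all `i`. -/
theorem stmt17 [IsNoetherianRing R] (a : Ideal R)
    (S : ModuleCat.{u} R → Prop)
    (hS : IsSerreClass S)
    (hC : CCond S a)
    (M : ModuleCat.{u} R) (hfin : Module.Finite R M) (hM : S M) (i : ℕ) :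
    S ((localCohomology a i).obj M) := by
  obtain ⟨e⟩ := nonempty_extLimit_equiv_localCohomology a i M
  exact hS.of_equiv e (hS.extLimit_mem hC (fun j => hS.ext_mem hM j (powQuot a 1)) i)
end

section
/- Let R be a commutative noetherian ring, let 𝔪_1, …, 𝔪_t be maximal ideals of R, let 𝔞 be an ideal of R, and let 𝒮 be a Serre subcategory of R-modules that satisfies the C_𝔞 condition and contains every R-module of finite length. Let M be a finitely generated R-module and let n be a non-negative integer such that Supp_R(H^i_𝔞(M)) ⊆ {𝔪_1, …, 𝔪_t} for all i ≤ n. Then H^i_𝔞(M) ∈ 𝒮 for all i ≤ n. -/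
universe u

open Submodule

variable {R : Type u} [CommRing R]

namespace LocalCohomologySerre

open CategoryTheory Abelian Limits Opposite

section OldExt

lemma pOpcycles_unop_injective (K : ChainComplex (ModuleCat.{u} R)ᵒᵖ ℕ) (n : ℕ) :
    Function.Injective (K.pOpcycles n).unop := by
  rw [← ModuleCat.mono_iff_injective]
  infer_instance

lemma exists_pOpcycles_unop_eq (K : ChainComplex (ModuleCat.{u} R)ᵒᵖ ℕ) (n : ℕ)
    (x : (K.X n).unop) (hx : (K.d (n + 1) n).unop x = 0) :
    ∃ z, (K.pOpcycles n).unop z = x := by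
  have h := (ShortComplex.exact_of_g_is_cokernel
    (ShortComplex.mk (K.d (n + 1) n) (K.pOpcycles n) (by simp))
    (K.opcyclesIsCokernel (n + 1) n (by simp))).unop
  rw [ShortComplex.moduleCat_exact_iff] at h
  exact h x hx

lemma homologyι_unop_surjective (K : ChainComplex (ModuleCat.{u} R)ᵒᵖ ℕ) (n : ℕ) :
    Function.Surjective (K.homologyι n).unop := by
  rw [← ModuleCat.epi_iff_surjective]
  infer_instance

lemma homologyι_unop_eq_zero_iff (K : ChainComplex (ModuleCat.{u} R)ᵒᵖ ℕ) (n j : ℕ)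
    (hj : (ComplexShape.down ℕ).next n = j) (z : (K.opcycles n).unop) :
    (K.homologyι n).unop z = 0 ↔
      ∃ y, (K.d n j).unop y = (K.pOpcycles n).unop z := by
  have h := (ShortComplex.exact_of_f_is_kernel
    (ShortComplex.mk (K.homologyι n) (K.fromOpcycles n j) (by simp))
    (K.homologyIsKernel n j hj)).unop
  have w : (K.fromOpcycles n j).unop ≫ (K.homologyι n).unop = 0 := by
    rw [← unop_comp, K.homologyι_comp_fromOpcycles, unop_zero]
  rw [ShortComplex.moduleCat_exact_iff] at h
  have hp (y) : (K.pOpcycles n).unop ((K.fromOpcycles n j).unop y) = (K.d n j).unop y := by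
    rw [← K.p_fromOpcycles n j, unop_comp]; rfl
  constructor
  · intro hz
    obtain ⟨y, hy⟩ := h z hz
    exact ⟨y, by rw [← hy, ← hp y]; rfl⟩
  · rintro ⟨y, hy⟩
    rw [← hp] at hy
    rw [← pOpcycles_unop_injective K n hy]
    exact congr($w y)

variable {X : ModuleCat.{u} R} (P : ProjectiveResolution X) (Y : ModuleCat.{u} R) (n : ℕ)

/-- The cocycles of degree `n` in the complex `Hom(P, Y)`. -/
def cocycles : Submodule R (P.complex.X n ⟶ Y) :=
  LinearMap.ker (Linear.leftComp R Y (P.complex.d (n + 1) n))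

variable {P Y n} in
lemma mem_cocycles_iff (f : P.complex.X n ⟶ Y) :
    f ∈ cocycles P Y n ↔ P.complex.d (n + 1) n ≫ f = 0 := Iff.rfl

/-- The class in `Ext` of a cocycle, as a linear map. -/
noncomputable def extMkLinear : cocycles P Y n →ₗ[R] Abelian.Ext X Y n where
  toFun f := P.extMk f.1 (n + 1) rfl ((mem_cocycles_iff _).1 f.2)
  map_add' f g := (P.add_extMk f.1 g.1 (n + 1) rfl ((mem_cocycles_iff _).1 f.2) ((mem_cocycles_iff _).1 g.2)).symm
  map_smul' r f := by
    rw [RingHom.id_apply, Abelian.Ext.smul_eq_comp_mk₀, P.extMk_comp_mk₀]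
    simp

lemma extMkLinear_surjective : Function.Surjective (extMkLinear P Y n) := by
  intro α
  obtain ⟨f, hf, rfl⟩ := P.extMk_surjective α (n + 1) rfl
  exact ⟨⟨f, hf⟩, rfl⟩

variable {P Y n} in
lemma extMkLinear_eq_zero_iff (f : cocycles P Y n) :
    extMkLinear P Y n f = 0 ↔
      ∃ g, P.complex.d n ((ComplexShape.down ℕ).next n) ≫ g = f.1 := by
  change P.extMk f.1 (n + 1) rfl ((mem_cocycles_iff _).1 f.2) = 0 ↔ _
  cases n with
  | succ n =>
    rw [P.extMk_eq_zero_iff _ _ _ _ n rfl, ChainComplex.next_nat_succ]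
  | zero =>
    have hf := f.2
    rw [mem_cocycles_iff] at hf
    simp only [← P.extEquivCohomologyClass.apply_eq_iff_eq,
      ProjectiveResolution.extEquivCohomologyClass_extMk,
      ProjectiveResolution.extEquivCohomologyClass_zero,
      CochainComplex.HomComplex.CohomologyClass.mk_eq_zero_iff]
    rw [CochainComplex.HomComplex.Cocycle.toSingleMk_mem_coboundaries_iff _ _ _ _ _ 1 (by lia)]
    have hd : P.cochainComplex.d 0 1 = 0 := by
      apply IsZero.eq_of_tgt
      exact P.cochainComplex.isZero_of_isStrictlyLE 0 1
    have hz : (0 : P.cochainComplex.X 0 ⟶ Y) = (P.cochainComplexXIso 0 0 (by simp)).hom ≫ f.1 ↔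
        f = 0 := by
      rw [eq_comm, Preadditive.IsIso.comp_left_eq_zero, ← Submodule.coe_eq_zero]
    simp [hd, eq_comm, hz]

end OldExt

section Comparison

variable {X : ModuleCat.{u} R} (P : ProjectiveResolution X) (Y : ModuleCat.{u} R) (n : ℕ)

/-- The complex `Hom(P, Y)`, with values in the opposite category. -/
noncomputable abbrev homComplex : ChainComplex (ModuleCat.{u} R)ᵒᵖ ℕ :=
  ((((linearYoneda R (ModuleCat.{u} R)).obj Y).rightOp).mapHomologicalComplex _).obj P.complex

/-- The cocycle attached to an element of the (unopposite of the) opcycles. -/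
noncomputable def toCocycles : ((homComplex P Y).opcycles n).unop →ₗ[R] cocycles P Y n :=
  LinearMap.codRestrict _ ((homComplex P Y).pOpcycles n).unop.hom (fun z ↦ by
    have h := (homComplex P Y).d_pOpcycles (n + 1) n
    exact congr($(congrArg Quiver.Hom.unop h) z))

lemma toCocycles_surjective : Function.Surjective (toCocycles P Y n) := by
  rintro ⟨f, hf⟩
  obtain ⟨z, hz⟩ := exists_pOpcycles_unop_eq (homComplex P Y) n f hf
  exact ⟨z, Subtype.ext hz⟩

/-- The projection from opcycles to the value of `_root_.Ext`. -/
noncomputable def toOldExt : ((homComplex P Y).opcycles n).unop →ₗ[R]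
    (((_root_.Ext R (ModuleCat.{u} R) n).obj (op X)).obj Y) :=
  ((P.isoLeftDerivedObj ((linearYoneda R (ModuleCat.{u} R)).obj Y).rightOp n).hom.unop).hom ∘ₗ
    ((homComplex P Y).homologyι n).unop.hom

lemma toOldExt_surjective : Function.Surjective (toOldExt P Y n) := by
  refine Function.Surjective.comp (g := ((P.isoLeftDerivedObj
    ((linearYoneda R (ModuleCat.{u} R)).obj Y).rightOp n).hom.unop))
    ?_ (homologyι_unop_surjective (homComplex P Y) n)
  rw [← ModuleCat.epi_iff_surjective]
  infer_instance

lemma ker_toOldExt :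
    LinearMap.ker (toOldExt P Y n) =
      LinearMap.ker (extMkLinear P Y n ∘ₗ toCocycles P Y n) := by
  ext z
  have hinj : Function.Injective ((P.isoLeftDerivedObj
      ((linearYoneda R (ModuleCat.{u} R)).obj Y).rightOp n).hom.unop) := by
    rw [← ModuleCat.mono_iff_injective]
    infer_instance
  rw [LinearMap.mem_ker, LinearMap.mem_ker, LinearMap.comp_apply, extMkLinear_eq_zero_iff]
  refine Iff.trans ?_ (homologyι_unop_eq_zero_iff (homComplex P Y) n _ rfl z)
  exact map_eq_zero_iff (ModuleCat.Hom.hom _) hinj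

/-- The comparison between the two definitions of `Ext`, using a projective resolution. -/
noncomputable def extComparison :
    (((_root_.Ext R (ModuleCat.{u} R) n).obj (op X)).obj Y) ≃ₗ[R] Abelian.Ext X Y n :=
  ((toOldExt P Y n).quotKerEquivOfSurjective (toOldExt_surjective P Y n)).symm ≪≫ₗ
    Submodule.quotEquivOfEq _ _ (ker_toOldExt P Y n) ≪≫ₗ
    (extMkLinear P Y n ∘ₗ toCocycles P Y n).quotKerEquivOfSurjective
      ((extMkLinear_surjective P Y n).comp (toCocycles_surjective P Y n))

lemma extComparison_toOldExt (z) :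
    extComparison P Y n (toOldExt P Y n z) = extMkLinear P Y n (toCocycles P Y n z) := by
  have : ((toOldExt P Y n).quotKerEquivOfSurjective (toOldExt_surjective P Y n)).symm
      (toOldExt P Y n z) = Submodule.Quotient.mk z := by
    rw [LinearEquiv.symm_apply_eq]
    rfl
  simp only [extComparison, LinearEquiv.trans_apply, this]
  rfl

lemma extComparison_naturality {X' : ModuleCat.{u} R} (P' : ProjectiveResolution X')
    (g : X' ⟶ X) (x : ((_root_.Ext R (ModuleCat.{u} R) n).obj (op X)).obj Y) :
    extComparison P' Y n ((((_root_.Ext R (ModuleCat.{u} R) n).map g.op).app Y) x) =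
      (Abelian.Ext.mk₀ g).comp (extComparison P Y n x) (zero_add n) := by
  obtain ⟨z, rfl⟩ := toOldExt_surjective P Y n x
  have hφ := ProjectiveResolution.lift_commutes_zero g P' P
  let φ : P'.Hom P g := ⟨ProjectiveResolution.lift g P' P, hφ⟩
  let F := ((linearYoneda R (ModuleCat.{u} R)).obj Y).rightOp
  let ψ : homComplex P' Y ⟶ homComplex P Y := (F.mapHomologicalComplex _).map φ.hom
  let z' := (HomologicalComplex.opcyclesMap ψ n).unop z
  have h1 : (((_root_.Ext R (ModuleCat.{u} R) n).map g.op).app Y) (toOldExt P Y n z) =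
      toOldExt P' Y n z' := by
    have h := ProjectiveResolution.isoLeftDerivedObj_hom_naturality g P' P φ.hom hφ F n
    have h2 := HomologicalComplex.homologyι_naturality ψ n
    have h3 := congr($(congrArg Quiver.Hom.unop h) (((homComplex P Y).homologyι n).unop z))
    have h4 := congr($(congrArg Quiver.Hom.unop h2) z)
    exact h3.trans congr((P'.isoLeftDerivedObj F n).hom.unop $h4)
  have h2 : (toCocycles P' Y n z').1 = φ.hom.f n ≫ (toCocycles P Y n z).1 := by
    have h := congrArg Quiver.Hom.unop (HomologicalComplex.p_opcyclesMap ψ n)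
    exact congr($h z)
  rw [h1, extComparison_toOldExt, extComparison_toOldExt]
  refine Eq.trans ?_ (ProjectiveResolution.mk₀_comp_extMk _ (n + 1) rfl
    ((mem_cocycles_iff _).1 (toCocycles P Y n z).2) φ).symm
  change P'.extMk _ _ rfl ((mem_cocycles_iff _).1 (toCocycles P' Y n z').2) = _
  simp only [h2]

end Comparison

section LocalCohomology

/-- The transition map `R ⧸ a ^ l ⟶ R ⧸ a ^ k` for `k ≤ l`. -/
noncomputable def quotPow (a : Ideal R) {k l : ℕ} (h : k ≤ l) :
    ModuleCat.of R (R ⧸ a ^ l) ⟶ ModuleCat.of R (R ⧸ a ^ k) :=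
  ModuleCat.ofHom (Submodule.mapQ _ _ LinearMap.id (Ideal.pow_le_pow_right h))

lemma quotPow_self (a : Ideal R) (k : ℕ) : quotPow a le_rfl = 𝟙 (ModuleCat.of R (R ⧸ a ^ k)) := by
  ext
  rfl

lemma quotPow_comp (a : Ideal R) {k l m : ℕ} (h : k ≤ l) (h' : l ≤ m) :
    quotPow a h' ≫ quotPow a h = quotPow a (h.trans h') := by
  ext
  rfl

/-- The transition maps between the modules `Ext(R ⧸ a ^ k, N)`. -/
noncomputable def transition (a : Ideal R) (N : ModuleCat.{u} R) (i : ℕ) (k l : ℕ) (h : k ≤ l) :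
    Abelian.Ext (ModuleCat.of R (R ⧸ a ^ k)) N i →ₗ[R]
      Abelian.Ext (ModuleCat.of R (R ⧸ a ^ l)) N i :=
  (Ext.mk₀ (quotPow a h)).precompOfLinear R N (zero_add i)

lemma transition_apply (a : Ideal R) (N : ModuleCat.{u} R) (i : ℕ) {k l : ℕ} (h : k ≤ l)
    (x : Abelian.Ext (ModuleCat.of R (R ⧸ a ^ k)) N i) :
    transition a N i k l h x = (Ext.mk₀ (quotPow a h)).comp x (zero_add i) := rfl

instance (a : Ideal R) (N : ModuleCat.{u} R) (i : ℕ) :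
    DirectedSystem (fun k : ℕ ↦ Abelian.Ext (ModuleCat.of R (R ⧸ a ^ k)) N i)
      (fun k l h ↦ transition a N i k l h) where
  map_self k x := by
    rw [transition_apply, quotPow_self, Ext.mk₀_id_comp]
  map_map k l m h h' x := by
    simp only [transition_apply]
    rw [← quotPow_comp a h h', ← Ext.mk₀_comp_mk₀, Ext.comp_assoc_of_second_deg_zero]

/-- The direct limit of the modules `Ext(R ⧸ a ^ k, N)`. -/
abbrev ExtLimit (a : Ideal R) (i : ℕ) (N : ModuleCat.{u} R) : Type u :=
  Module.DirectLimit (fun k : ℕ ↦ Abelian.Ext (ModuleCat.of R (R ⧸ a ^ k)) N i)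
    (transition a N i)

/-- A chosen projective resolution of `R ⧸ a ^ k`. -/
noncomputable abbrev powResolution (a : Ideal R) (k : ℕ) :
    ProjectiveResolution (ModuleCat.of R (R ⧸ a ^ k)) :=
  projectiveResolution _

/-- The map from `Ext(R ⧸ a ^ k, N)` to local cohomology. -/
noncomputable def toLocalCohomology (a : Ideal R) (i : ℕ) (N : ModuleCat.{u} R) (k : ℕ) :
    Abelian.Ext (ModuleCat.of R (R ⧸ a ^ k)) N i →ₗ[R] (localCohomology a i).obj N :=
  ((colimit.ι (localCohomology.diagram (localCohomology.idealPowersDiagram a) i)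
    (op (op k))).app N).hom ∘ₗ (extComparison (powResolution a k) N i).symm.toLinearMap

lemma toLocalCohomology_extComparison (a : Ideal R) (i : ℕ) (N : ModuleCat.{u} R) (k : ℕ)
    (y : ((_root_.Ext R (ModuleCat.{u} R) i).obj (op (ModuleCat.of R (R ⧸ a ^ k)))).obj N) :
    toLocalCohomology a i N k (extComparison (powResolution a k) N i y) =
      (colimit.ι (localCohomology.diagram (localCohomology.idealPowersDiagram a) i)
        (op (op k))).app N y :=
  congrArg ((colimit.ι (localCohomology.diagram (localCohomology.idealPowersDiagram a) i)
    (op (op k))).app N) ((extComparison (powResolution a k) N i).symm_apply_apply y)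

lemma toLocalCohomology_transition (a : Ideal R) (i : ℕ) (N : ModuleCat.{u} R) (k l : ℕ)
    (h : k ≤ l) (x : Abelian.Ext (ModuleCat.of R (R ⧸ a ^ k)) N i) :
    toLocalCohomology a i N l (transition a N i k l h x) = toLocalCohomology a i N k x := by
  obtain ⟨y, rfl⟩ := (extComparison (powResolution a k) N i).surjective x
  rw [transition_apply, ← extComparison_naturality (powResolution a k) N i (powResolution a l)]
  rw [toLocalCohomology_extComparison, toLocalCohomology_extComparison]
  have h := congrArg (fun f ↦ NatTrans.app f N) (colimit.w
    (localCohomology.diagram (localCohomology.idealPowersDiagram a) i) (homOfLE h).op.op)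
  exact ConcreteCategory.congr_hom h y

/-- The comparison from the direct limit to local cohomology. -/
noncomputable def extLimitToLocalCohomology (a : Ideal R) (i : ℕ) (N : ModuleCat.{u} R) :
    ExtLimit a i N →ₗ[R] (localCohomology a i).obj N :=
  Module.DirectLimit.lift R ℕ _ _ (toLocalCohomology a i N)
    (fun k l h x ↦ toLocalCohomology_transition a i N k l h x)

lemma exists_map_eq_zero_of_isColimit {J : Type} [SmallCategory J] [IsFiltered J]
    (F : J ⥤ ModuleCat.{u} R) (t : Cocone F) (ht : IsColimit t) {j : J} (x : F.obj j)
    (hx : t.ι.app j x = 0) : ∃ (k : J) (f : j ⟶ k), F.map f x = 0 := by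
  have : PreservesFilteredColimitsOfSize.{0, 0} (forget (ModuleCat.{u} R)) :=
    preservesFilteredColimitsOfSize_shrink.{0, u, 0, u} _
  obtain ⟨k, f, hf⟩ := (IsColimit.eq_iff' ht x 0).1 (by rw [map_zero]; exact hx)
  exact ⟨k, f, by rw [hf, map_zero]⟩

lemma exists_rep_of_isColimit {J : Type} [SmallCategory J] [IsFiltered J]
    (F : J ⥤ ModuleCat.{u} R) (t : Cocone F) (ht : IsColimit t) (x : t.pt) :
    ∃ (j : J) (y : F.obj j), t.ι.app j y = x := by
  have : PreservesFilteredColimitsOfSize.{0, 0} (forget (ModuleCat.{u} R)) :=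
    preservesFilteredColimitsOfSize_shrink.{0, u, 0, u} _
  exact Concrete.isColimit_exists_rep _ ht x

lemma extLimitToLocalCohomology_injective (a : Ideal R) (i : ℕ) (N : ModuleCat.{u} R) :
    Function.Injective (extLimitToLocalCohomology a i N) := by
  rw [injective_iff_map_eq_zero]
  intro x hx
  induction x using Module.DirectLimit.induction_on with
  | _ k x =>
    obtain ⟨y, rfl⟩ := (extComparison (powResolution a k) N i).surjective x
    rw [extLimitToLocalCohomology, Module.DirectLimit.lift_of,
      toLocalCohomology_extComparison] at hx
    obtain ⟨j, f, hj⟩ := exists_map_eq_zero_of_isColimit _ _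
      (isColimitOfPreserves ((evaluation _ _).obj N) (colimit.isColimit
        (localCohomology.diagram (localCohomology.idealPowersDiagram a) i)))
      (j := op (op k)) y hx
    have h : k ≤ j.unop.unop := leOfHom f.unop.unop
    rw [← Module.DirectLimit.of_f (hij := h), transition_apply,
      ← extComparison_naturality (powResolution a k) N i (powResolution a j.unop.unop)]
    have hj' : ((_root_.Ext R (ModuleCat.{u} R) i).map (quotPow a h).op).app N y = 0 := hj
    rw [hj', map_zero, map_zero]

lemma extLimitToLocalCohomology_surjective (a : Ideal R) (i : ℕ) (N : ModuleCat.{u} R) :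
    Function.Surjective (extLimitToLocalCohomology a i N) := by
  intro x
  obtain ⟨j, y, hy⟩ := exists_rep_of_isColimit _ _
    (isColimitOfPreserves ((evaluation _ _).obj N) (colimit.isColimit
      (localCohomology.diagram (localCohomology.idealPowersDiagram a) i))) x
  refine ⟨Module.DirectLimit.of R ℕ _ _ j.unop.unop
    (extComparison (powResolution a j.unop.unop) N i y), ?_⟩
  rw [extLimitToLocalCohomology, Module.DirectLimit.lift_of]
  exact (toLocalCohomology_extComparison a i N j.unop.unop y).trans hy

/-- Local cohomology is the direct limit of the modules `Ext(R ⧸ a ^ k, N)`. -/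
noncomputable def extLimitEquiv (a : Ideal R) (i : ℕ) (N : ModuleCat.{u} R) :
    ExtLimit a i N ≃ₗ[R] (localCohomology a i).obj N :=
  LinearEquiv.ofBijective _ ⟨extLimitToLocalCohomology_injective a i N,
    extLimitToLocalCohomology_surjective a i N⟩

end LocalCohomology

section SerreClass

variable {S : ModuleCat.{u} R → Prop} {A B C : Type u} [AddCommGroup A] [Module R A]
  [AddCommGroup B] [Module R B] [AddCommGroup C] [Module R C]

lemma _root_.IsSerreClass.of_equiv_s18 (hS : IsSerreClass S) (e : A ≃ₗ[R] B) (h : S (ModuleCat.of R A)) :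
    S (ModuleCat.of R B) :=
  hS.iso (M := ModuleCat.of R A) (N := ModuleCat.of R B) e h

lemma _root_.IsSerreClass.of_injective_s18 (hS : IsSerreClass S) (f : A →ₗ[R] B)
    (hf : Function.Injective f) (h : S (ModuleCat.of R B)) : S (ModuleCat.of R A) :=
  hS.of_equiv_s18 (LinearEquiv.ofInjective f hf).symm (hS.subobj (ModuleCat.of R B) (LinearMap.range f) h)

lemma _root_.IsSerreClass.of_surjective_s18 (hS : IsSerreClass S) (f : A →ₗ[R] B)
    (hf : Function.Surjective f) (h : S (ModuleCat.of R A)) : S (ModuleCat.of R B) :=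
  hS.of_equiv_s18 (f.quotKerEquivOfSurjective hf) (hS.quot (ModuleCat.of R A) (LinearMap.ker f) h)

lemma _root_.IsSerreClass.of_exact_s18 (hS : IsSerreClass S) (f : A →ₗ[R] B) (g : B →ₗ[R] C)
    (hfg : ∀ b, g b = 0 → ∃ a, f a = b) (hA : S (ModuleCat.of R A))
    (hC : S (ModuleCat.of R C)) : S (ModuleCat.of R B) := by
  refine hS.extension (ModuleCat.of R B) (LinearMap.ker g) ?_ ?_
  · refine hS.of_injective_s18 (Submodule.inclusion (p := LinearMap.ker g) (p' := LinearMap.range f)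
      fun b hb ↦ hfg b hb) (Submodule.inclusion_injective _) ?_
    exact hS.of_surjective_s18 f.rangeRestrict f.surjective_rangeRestrict hA
  · exact hS.of_equiv_s18 g.quotKerEquivRange.symm (hS.subobj (ModuleCat.of R C) (LinearMap.range g) hC)

lemma _root_.IsSerreClass.prod (hS : IsSerreClass S) (hA : S (ModuleCat.of R A))
    (hB : S (ModuleCat.of R B)) : S (ModuleCat.of R (A × B)) :=
  hS.of_exact_s18 (LinearMap.inl R A B) (LinearMap.snd R A B)
    (fun b hb ↦ ⟨b.1, Prod.ext rfl hb.symm⟩) hA hB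

lemma _root_.IsSerreClass.pi_fin_s18 (hS : IsSerreClass S) (hA : S (ModuleCat.of R A)) (m : ℕ) :
    S (ModuleCat.of R (Fin m → A)) := by
  induction m with
  | zero => exact hS.zero _ inferInstance
  | succ m ih =>
    exact hS.of_equiv_s18 (Fin.consLinearEquiv R fun _ ↦ A) (hS.prod hA ih)

end SerreClass

section Torsion

variable {N : Type u} [AddCommGroup N] [Module R N] {a : Ideal R}

lemma mem_torsionGamma_iff {x : N} :
    x ∈ torsionGamma a N ↔ ∃ k : ℕ, ∀ r ∈ a ^ k, r • x = 0 := by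
  rw [torsionGamma, Submodule.mem_iSup_of_directed]
  · simp only [Submodule.mem_torsionBySet_iff]
    simp
  · refine Monotone.directed_le fun k l h ↦ ?_
    exact Submodule.torsionBySet_le_torsionBySet_of_subset (Ideal.pow_le_pow_right h)

lemma exists_pow_smul_eq_zero_of_le_torsionGamma (P : Submodule R N) (hP : P.FG)
    (h : P ≤ torsionGamma a N) : ∃ k : ℕ, ∀ r ∈ a ^ k, ∀ x ∈ P, r • x = 0 := by
  have hc := (Submodule.fg_iff_compact P).1 hP
  rw [CompleteLattice.isCompactElement_iff_le_of_directed_sSup_le] at hc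
  obtain ⟨_, ⟨k, rfl⟩, hk⟩ := hc _ (Set.range_nonempty _) (Monotone.directed_le (fun k l h ↦
    Submodule.torsionBySet_le_torsionBySet_of_subset
      (Ideal.pow_le_pow_right h))).directedOn_range h
  exact ⟨k, fun r hr x hx ↦ (Submodule.mem_torsionBySet_iff _ _).1 (hk hx) ⟨r, hr⟩⟩

lemma mem_torsionGamma_of_smul_mem [IsNoetherianRing R] {x : N}
    (h : ∀ r ∈ a, r • x ∈ torsionGamma a N) : x ∈ torsionGamma a N := by
  obtain ⟨k, hk⟩ := exists_pow_smul_eq_zero_of_le_torsionGamma (a • (R ∙ x))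
    (Submodule.FG.smul (IsNoetherian.noetherian a) (Submodule.fg_span_singleton x)) (by
      rw [Submodule.smul_le]
      intro r hr y hy
      obtain ⟨s, rfl⟩ := Submodule.mem_span_singleton.1 hy
      rw [smul_comm]
      exact Submodule.smul_mem _ _ (h r hr))
  refine mem_torsionGamma_iff.2 ⟨k + 1, fun r hr ↦ ?_⟩
  rw [pow_succ] at hr
  refine Submodule.mul_induction_on hr (fun r hr s hs ↦ ?_) (fun r s hr hs ↦ ?_)
  · rw [mul_smul]
    exact hk r hr _ (Submodule.smul_mem_smul hs (Submodule.mem_span_singleton_self x))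
  · rw [add_smul, hr, hs, add_zero]

lemma torsionGamma_torsionGamma : torsionGamma a (torsionGamma a N) = ⊤ := by
  rw [eq_top_iff]
  rintro ⟨x, hx⟩ -
  obtain ⟨k, hk⟩ := mem_torsionGamma_iff.1 hx
  exact mem_torsionGamma_iff.2 ⟨k, fun r hr ↦ Subtype.ext (hk r hr)⟩

lemma torsionGamma_quotient [IsNoetherianRing R] :
    torsionGamma a (N ⧸ torsionGamma a N) = ⊥ := by
  rw [eq_bot_iff]
  intro x hx
  obtain ⟨k, hk⟩ := mem_torsionGamma_iff.1 hx
  obtain ⟨x, rfl⟩ := Submodule.mkQ_surjective _ x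
  clear hx
  suffices x ∈ torsionGamma a N by simpa using this
  induction k generalizing x with
  | zero => simpa using hk 1 (by simp)
  | succ k ih =>
    refine mem_torsionGamma_of_smul_mem fun r hr ↦ ih _ fun s hs ↦ ?_
    rw [map_smul, ← mul_smul]
    exact hk _ (by rw [pow_succ]; exact Ideal.mul_mem_mul hs hr)

lemma torsionGamma_eq_top_of_surjective {N' : Type u} [AddCommGroup N'] [Module R N']
    (f : N →ₗ[R] N') (hf : Function.Surjective f) (h : torsionGamma a N = ⊤) :
    torsionGamma a N' = ⊤ := by
  rw [eq_top_iff]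
  intro x _
  obtain ⟨x, rfl⟩ := hf x
  obtain ⟨k, hk⟩ := mem_torsionGamma_iff.1 (h ▸ Submodule.mem_top : x ∈ torsionGamma a N)
  exact mem_torsionGamma_iff.2 ⟨k, fun r hr ↦ by rw [← map_smul, hk r hr, map_zero]⟩

lemma map_mem_torsionGamma {N' : Type u} [AddCommGroup N'] [Module R N']
    (f : N →ₗ[R] N') {x : N} (h : x ∈ torsionGamma a N) : f x ∈ torsionGamma a N' := by
  obtain ⟨k, hk⟩ := mem_torsionGamma_iff.1 h
  exact mem_torsionGamma_iff.2 ⟨k, fun r hr ↦ by rw [← map_smul, hk r hr, map_zero]⟩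

/-- Over a noetherian ring, the `a`-torsion submodule of an injective module is injective. -/
lemma injective_torsionGamma [IsNoetherianRing R] (h : Module.Injective R N) :
    Module.Injective R (torsionGamma a N) := by
  refine Module.Baer.injective fun I g ↦ ?_
  obtain ⟨k, hk⟩ := exists_pow_smul_eq_zero_of_le_torsionGamma (a := a)
    (LinearMap.range ((torsionGamma a N).subtype ∘ₗ g))
    (by rw [← Submodule.map_top]; exact (IsNoetherian.noetherian ⊤).map _)
    (by rintro _ ⟨x, rfl⟩; exact (g x).2)
  obtain ⟨m, hm⟩ := Ideal.exists_pow_inf_eq_pow_smul a (I : Submodule R R)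
  have hle : Submodule.comap I.subtype (a ^ (k + m)) ≤
      LinearMap.ker ((torsionGamma a N).subtype ∘ₗ g) := by
    intro x hx
    have hx' : x.1 ∈ a ^ k • (I : Submodule R R) := by
      refine Submodule.smul_mono le_rfl (inf_le_right (a := a ^ m • ⊤)) ?_
      have := hm (k + m) (by lia)
      rw [Nat.add_sub_cancel] at this
      rw [← this]
      exact ⟨by simpa using hx, x.2⟩
    have hx'' : x ∈ a ^ k • (⊤ : Submodule R I) := by
      have h : x.1 ∈ (a ^ k • (⊤ : Submodule R I)).map I.subtype := by
        rw [Submodule.map_smul'']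
        simpa using hx'
      obtain ⟨y, hy, hxy⟩ := h
      rwa [← Subtype.ext hxy]
    refine (Submodule.smul_le (P := LinearMap.ker _)).2 (fun r hr y _ ↦ ?_) hx''
    rw [LinearMap.mem_ker, map_smul]
    exact hk r hr _ ⟨y, rfl⟩
  obtain ⟨φ, hφ⟩ := h.out
    (Submodule.mapQ (Submodule.comap I.subtype (a ^ (k + m))) (a ^ (k + m)) I.subtype le_rfl)
    (by
      rw [← LinearMap.ker_eq_bot, Submodule.ker_mapQ]
      simp)
    (Submodule.liftQ _ ((torsionGamma a N).subtype ∘ₗ g) hle)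
  refine ⟨LinearMap.codRestrict _ (φ ∘ₗ Submodule.mkQ _) (fun x ↦ ?_), fun x hx ↦ ?_⟩
  · refine map_mem_torsionGamma φ (mem_torsionGamma_iff.2 ⟨k + m, fun r hr ↦ ?_⟩)
    rw [← map_smul, Submodule.mkQ_apply, Submodule.Quotient.mk_eq_zero]
    exact Ideal.mul_mem_right x _ hr
  · exact Subtype.ext (hφ (Submodule.Quotient.mk ⟨x, hx⟩))

end Torsion

section ExtModules

lemma _root_.IsSerreClass.ext [IsNoetherianRing R] {S : ModuleCat.{u} R → Prop}
    (hS : IsSerreClass S) (X T : ModuleCat.{u} R) [Module.Finite R X] (h : S T) (i : ℕ) :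
    S (ModuleCat.of R (Abelian.Ext X T i)) := by
  induction i generalizing X with
  | zero =>
    obtain ⟨m, f, hf⟩ := Module.Finite.exists_fin' R X
    refine hS.of_injective_s18 ((LinearMap.pi fun j ↦ LinearMap.applyₗ (f (Pi.single j 1))) ∘ₗ
      (Ext.linearEquiv₀.trans ModuleCat.homLinearEquiv).toLinearMap) ?_ (hS.pi_fin_s18 (A := T) h m)
    rw [LinearMap.coe_comp]
    refine Function.Injective.comp (fun φ ψ hφψ ↦ ?_) (LinearEquiv.injective _)
    have h' : φ ∘ₗ f = ψ ∘ₗ f := by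
      refine LinearMap.pi_ext' fun j ↦ LinearMap.ext_ring ?_
      simpa using congrFun hφψ j
    exact (LinearMap.cancel_right hf).1 h'
  | succ n ih =>
    obtain ⟨N, _, _, _, _, f, surjf⟩ := Module.exists_finite_presentation R X
    let exac := LinearMap.shortExact_shortComplexKer surjf
    exact hS.of_surjective_s18 (exac.extClass.precompOfLinear R T (add_comm 1 n))
      (precomp_extClass_surjective_of_projective_X₂ T exac n) (ih _)

/-- The short complex `A ⟶ B ⟶ B ⧸ range f` attached to a linear map `f`. -/
noncomputable abbrev cokernelComplex {A B : Type u} [AddCommGroup A] [Module R A]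
    [AddCommGroup B] [Module R B] (f : A →ₗ[R] B) : ShortComplex (ModuleCat.{u} R) :=
  ModuleCat.shortComplexOfCompEqZero f f.range.mkQ (LinearMap.range_mkQ_comp f)

lemma cokernelComplex_shortExact {A B : Type u} [AddCommGroup A] [Module R A]
    [AddCommGroup B] [Module R B] (f : A →ₗ[R] B) (hf : Function.Injective f) :
    (cokernelComplex f).ShortExact :=
  ModuleCat.shortComplex_shortExact _ (LinearMap.exact_map_mkQ_range f) hf
    (Submodule.mkQ_surjective _)

/-- The short complex `P ⟶ N ⟶ N ⧸ P` attached to a submodule. -/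
noncomputable abbrev quotientComplex {N : Type u} [AddCommGroup N] [Module R N]
    (P : Submodule R N) : ShortComplex (ModuleCat.{u} R) :=
  ModuleCat.shortComplexOfCompEqZero P.subtype P.mkQ (by ext; simp)

lemma quotientComplex_shortExact {N : Type u} [AddCommGroup N] [Module R N]
    (P : Submodule R N) : (quotientComplex P).ShortExact :=
  ModuleCat.shortComplex_shortExact _ (LinearMap.exact_subtype_mkQ P) P.subtype_injective
    P.mkQ_surjective

variable {a : Ideal R}

lemma hom_quotPow_ext {N : ModuleCat.{u} R} {k : ℕ}
    {f g : ModuleCat.of R (R ⧸ a ^ k) ⟶ N}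
    (h : f (Submodule.Quotient.mk 1) = g (Submodule.Quotient.mk 1)) : f = g := by
  ext
  exact h

lemma exists_hom_quotPow {N : ModuleCat.{u} R} {k : ℕ} {x : N} (hx : ∀ r ∈ a ^ k, r • x = 0) :
    ∃ f : ModuleCat.of R (R ⧸ a ^ k) ⟶ N, f (Submodule.Quotient.mk 1) = x :=
  ⟨ModuleCat.ofHom (Submodule.liftQ _ (LinearMap.toSpanSingleton R N x) hx), one_smul R x⟩

lemma smul_hom_quotPow_one {N : ModuleCat.{u} R} {k : ℕ}
    (f : ModuleCat.of R (R ⧸ a ^ k) ⟶ N) {r : R} (hr : r ∈ a ^ k) :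
    (r • f (Submodule.Quotient.mk 1) : N) = 0 := by
  rw [← map_smul]
  have : r • (Submodule.Quotient.mk 1 : R ⧸ a ^ k) = 0 := by
    rw [← Submodule.Quotient.mk_smul, Submodule.Quotient.mk_eq_zero]
    simpa using hr
  exact (congrArg f.hom this).trans (map_zero f.hom)

lemma hom_quotPow_one_mem {N : ModuleCat.{u} R} {k : ℕ}
    (f : ModuleCat.of R (R ⧸ a ^ k) ⟶ N) : f (Submodule.Quotient.mk 1) ∈ torsionGamma a N :=
  mem_torsionGamma_iff.2 ⟨k, fun _ hr ↦ smul_hom_quotPow_one f hr⟩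

lemma ext_quotPow_zero_eq_zero {N : ModuleCat.{u} R} (hN : torsionGamma a N = ⊥) {k : ℕ}
    (x : Abelian.Ext (ModuleCat.of R (R ⧸ a ^ k)) N 0) : x = 0 := by
  obtain ⟨f, rfl⟩ := (Ext.mk₀_bijective _ _).2 x
  have : f = 0 := hom_quotPow_ext (by simpa [hN] using hom_quotPow_one_mem f)
  rw [this, Ext.mk₀_zero]

/-- Over a noetherian ring, an `a`-torsion module embeds into an `a`-torsion injective module. -/
lemma exists_torsion_injective_embedding [IsNoetherianRing R] {T : ModuleCat.{u} R}
    (hT : torsionGamma a T = ⊤) :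
    ∃ (E : ModuleCat.{u} R) (f : T →ₗ[R] E), Function.Injective f ∧ Injective E ∧
      torsionGamma a E = ⊤ := by
  have hE : Module.Injective R (Injective.under T : ModuleCat.{u} R) :=
    (Module.injective_iff_injective_object R _).2 (inferInstanceAs (Injective (Injective.under T)))
  have hι : Function.Injective (Injective.ι T).hom := (ModuleCat.mono_iff_injective _).1 inferInstance
  refine ⟨ModuleCat.of R (torsionGamma a (Injective.under T : ModuleCat.{u} R)),
    LinearMap.codRestrict _ (Injective.ι T).hom fun x ↦
      map_mem_torsionGamma _ (hT ▸ Submodule.mem_top), fun x y h ↦ hι (congrArg Subtype.val h),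
    (Module.injective_iff_injective_object R _).1 (injective_torsionGamma hE),
    torsionGamma_torsionGamma⟩

/-- Positive degree extension classes with values in an `a`-torsion module die in the limit. -/
lemma exists_transition_eq_zero [IsNoetherianRing R] {T : ModuleCat.{u} R}
    (hT : torsionGamma a T = ⊤) (j k : ℕ)
    (x : Abelian.Ext (ModuleCat.of R (R ⧸ a ^ k)) T (j + 1)) :
    ∃ (l : ℕ) (h : k ≤ l), transition a T (j + 1) k l h x = 0 := by
  induction j generalizing T k with
  | zero =>
    obtain ⟨E, f, hf, hE, hEt⟩ := exists_torsion_injective_embedding hT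
    have hs := cokernelComplex_shortExact f hf
    obtain ⟨y, hy⟩ := Ext.covariant_sequence_exact₁ _ hs x
      (@Ext.eq_zero_of_injective _ _ _ _ _ _ _ hE _) (zero_add 1)
    obtain ⟨φ, rfl⟩ := (Ext.mk₀_bijective _ _).2 y
    obtain ⟨e, he⟩ := Submodule.mkQ_surjective f.range (φ (Submodule.Quotient.mk 1))
    obtain ⟨l, hl⟩ := mem_torsionGamma_iff.1 (hEt ▸ Submodule.mem_top : e ∈ torsionGamma a E)
    obtain ⟨ψ, hψ⟩ := exists_hom_quotPow (N := E) (k := max k l) (x := e)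
      fun r hr ↦ hl r (Ideal.pow_le_pow_right (le_max_right _ _) hr)
    refine ⟨max k l, le_max_left _ _, ?_⟩
    have h : quotPow a (le_max_left k l) ≫ φ = ψ ≫ (cokernelComplex f).g := by
      refine hom_quotPow_ext ?_
      refine he.symm.trans (congrArg f.range.mkQ hψ.symm)
    rw [transition_apply, ← hy, ← Ext.comp_assoc_of_second_deg_zero, Ext.mk₀_comp_mk₀, h,
      ← Ext.mk₀_comp_mk₀, Ext.comp_assoc_of_second_deg_zero, hs.comp_extClass, Ext.comp_zero]
  | succ j ih =>
    obtain ⟨E, f, hf, hE, hEt⟩ := exists_torsion_injective_embedding hT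
    have hs := cokernelComplex_shortExact f hf
    obtain ⟨y, hy⟩ := Ext.covariant_sequence_exact₁ _ hs x
      (@Ext.eq_zero_of_injective _ _ _ _ _ _ _ hE _) (n₀ := j + 1) rfl
    obtain ⟨l, h, hl⟩ := ih (T := (cokernelComplex f).X₃)
      (torsionGamma_eq_top_of_surjective _ (Submodule.mkQ_surjective f.range) hEt) k y
    refine ⟨l, h, ?_⟩
    rw [transition_apply, ← hy, ← Ext.comp_assoc (h₁₂ := zero_add _)]
    rw [transition_apply] at hl
    rw [hl, Ext.zero_comp]
    lia

end ExtModules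

section DimensionShifting

variable {a : Ideal R}

/-- Evaluation of `Hom(R ⧸ a ^ k, N)` at the class of `1`. -/
noncomputable def evalOne (a : Ideal R) (N : ModuleCat.{u} R) (k : ℕ) :
    Abelian.Ext (ModuleCat.of R (R ⧸ a ^ k)) N 0 →ₗ[R] N :=
  LinearMap.applyₗ (Submodule.Quotient.mk 1 : R ⧸ a ^ k) ∘ₗ
    (Ext.linearEquiv₀.trans ModuleCat.homLinearEquiv).toLinearMap

lemma evalOne_mk₀ (N : ModuleCat.{u} R) {k : ℕ} (f : ModuleCat.of R (R ⧸ a ^ k) ⟶ N) :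
    evalOne a N k (Ext.mk₀ f) = f (Submodule.Quotient.mk 1) := by
  have : Ext.linearEquiv₀ (R := R) (Ext.mk₀ f) = f :=
    (Ext.mk₀_bijective _ _).1 (Ext.mk₀_linearEquiv₀_apply _)
  exact congrArg (fun g : ModuleCat.of R (R ⧸ a ^ k) ⟶ N ↦ g.hom (Submodule.Quotient.mk 1)) this

lemma evalOne_injective (N : ModuleCat.{u} R) (k : ℕ) : Function.Injective (evalOne a N k) := by
  intro x y h
  obtain ⟨f, rfl⟩ := (Ext.mk₀_bijective _ _).2 x
  obtain ⟨g, rfl⟩ := (Ext.mk₀_bijective _ _).2 y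
  rw [evalOne_mk₀, evalOne_mk₀] at h
  rw [hom_quotPow_ext h]

lemma exists_evalOne_eq {N : ModuleCat.{u} R} {k : ℕ} {x : N} (hx : ∀ r ∈ a ^ k, r • x = 0) :
    ∃ y, evalOne a N k y = x := by
  obtain ⟨f, hf⟩ := exists_hom_quotPow hx
  exact ⟨Ext.mk₀ f, (evalOne_mk₀ N f).trans hf⟩

lemma evalOne_transition (N : ModuleCat.{u} R) (k l : ℕ) (h : k ≤ l)
    (x : Abelian.Ext (ModuleCat.of R (R ⧸ a ^ k)) N 0) :
    evalOne a N l (transition a N 0 k l h x) = evalOne a N k x := by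
  obtain ⟨f, rfl⟩ := (Ext.mk₀_bijective _ _).2 x
  rw [transition_apply, Ext.mk₀_comp_mk₀, evalOne_mk₀, evalOne_mk₀]
  rfl

/-- The zeroth local cohomology is the torsion submodule. -/
lemma exists_extLimit_zero_equiv (a : Ideal R) (N : ModuleCat.{u} R) :
    Nonempty (ExtLimit a 0 N ≃ₗ[R] torsionGamma a N) := by
  let ev : ExtLimit a 0 N →ₗ[R] N :=
    Module.DirectLimit.lift R ℕ _ _ (evalOne a N) (evalOne_transition N)
  have hev : Function.Injective ev :=
    Module.DirectLimit.lift_injective _ _ (evalOne_injective N)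
  refine ⟨(LinearEquiv.ofInjective ev hev).trans (LinearEquiv.ofEq _ _ (le_antisymm ?_ ?_))⟩
  · rintro _ ⟨x, rfl⟩
    induction x using Module.DirectLimit.induction_on with
    | _ k x =>
      obtain ⟨f, rfl⟩ := (Ext.mk₀_bijective _ _).2 x
      rw [Module.DirectLimit.lift_of, evalOne_mk₀]
      exact hom_quotPow_one_mem f
  · intro x hx
    obtain ⟨k, hk⟩ := mem_torsionGamma_iff.1 hx
    obtain ⟨y, hy⟩ := exists_evalOne_eq hk
    exact ⟨Module.DirectLimit.of R ℕ _ _ k y, (Module.DirectLimit.lift_of ..).trans hy⟩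

/-- The map on `ExtLimit` induced by composition with an extension class. -/
noncomputable def extLimitMap (a : Ideal R) {N L : ModuleCat.{u} R} {d : ℕ}
    (β : Abelian.Ext N L d) {i j : ℕ} (h : i + d = j) : ExtLimit a i N →ₗ[R] ExtLimit a j L :=
  Module.DirectLimit.map (fun k ↦ β.postcompOfLinear R (ModuleCat.of R (R ⧸ a ^ k)) h)
    (fun k l hkl ↦ by
      ext x
      exact Ext.comp_assoc (Ext.mk₀ (quotPow a hkl)) x β (zero_add i) h (by lia))

lemma extLimitMap_of {N L : ModuleCat.{u} R} {d : ℕ} (β : Abelian.Ext N L d) {i j : ℕ}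
    (h : i + d = j) {k : ℕ} (x : Abelian.Ext (ModuleCat.of R (R ⧸ a ^ k)) N i) :
    extLimitMap a β h (Module.DirectLimit.of R ℕ _ _ k x) =
      Module.DirectLimit.of R ℕ (fun k ↦ Abelian.Ext (ModuleCat.of R (R ⧸ a ^ k)) L j)
        (transition a L j) k (x.comp β h) :=
  Module.DirectLimit.map_apply_of ..

lemma extLimitMap_bijective {N L : ModuleCat.{u} R} {d : ℕ} (β : Abelian.Ext N L d) {i j : ℕ}
    (h : i + d = j)
    (hinj : ∀ (k : ℕ) (x : Abelian.Ext (ModuleCat.of R (R ⧸ a ^ k)) N i), x.comp β h = 0 →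
      ∃ (l : ℕ) (hl : k ≤ l), transition a N i k l hl x = 0)
    (hsurj : ∀ (k : ℕ) (y : Abelian.Ext (ModuleCat.of R (R ⧸ a ^ k)) L j),
      ∃ (l : ℕ) (hl : k ≤ l) (x : Abelian.Ext (ModuleCat.of R (R ⧸ a ^ l)) N i),
        x.comp β h = transition a L j k l hl y) :
    Function.Bijective (extLimitMap a β h) := by
  constructor
  · rw [injective_iff_map_eq_zero]
    intro x hx
    induction x using Module.DirectLimit.induction_on with
    | _ k x =>
      rw [extLimitMap_of] at hx
      obtain ⟨l, hl, hxl⟩ := Module.DirectLimit.of.zero_exact hx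
      have hxl' : (transition a N i k l hl x).comp β h = 0 := by
        refine Eq.trans ?_ hxl
        exact Ext.comp_assoc (Ext.mk₀ (quotPow a hl)) x β (zero_add i) h (by lia)
      obtain ⟨l', hl', hx'⟩ := hinj l _ hxl'
      rw [← Module.DirectLimit.of_f (hij := hl), ← Module.DirectLimit.of_f (hij := hl'), hx',
        map_zero]
  · intro y
    induction y using Module.DirectLimit.induction_on with
    | _ k y =>
      obtain ⟨l, hl, x, hx⟩ := hsurj k y
      refine ⟨Module.DirectLimit.of R ℕ _ _ l x, ?_⟩
      rw [extLimitMap_of, hx, Module.DirectLimit.of_f]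

/-- Passing to the quotient by the torsion submodule does not change the positive degree
local cohomology. -/
lemma exists_extLimit_quotient_equiv [IsNoetherianRing R] (a : Ideal R) (N : ModuleCat.{u} R)
    (j : ℕ) : Nonempty (ExtLimit a (j + 1) N ≃ₗ[R]
      ExtLimit a (j + 1) (ModuleCat.of R (N ⧸ torsionGamma a N))) := by
  have hs := quotientComplex_shortExact (torsionGamma a N)
  have hT : torsionGamma a (quotientComplex (torsionGamma a N)).X₁ = ⊤ := torsionGamma_torsionGamma
  refine ⟨LinearEquiv.ofBijective (extLimitMap a (Ext.mk₀ (quotientComplex (torsionGamma a N)).g)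
    (add_zero (j + 1))) (extLimitMap_bijective _ _ (fun k x hx ↦ ?_) fun k y ↦ ?_)⟩
  · obtain ⟨y, rfl⟩ := Ext.covariant_sequence_exact₂ _ hs x hx
    obtain ⟨l, hl, hy⟩ := exists_transition_eq_zero hT j k y
    refine ⟨l, hl, ?_⟩
    rw [transition_apply] at hy ⊢
    rw [← Ext.comp_assoc_of_third_deg_zero, hy, Ext.zero_comp]
  · obtain ⟨l, hl, hy⟩ := exists_transition_eq_zero hT (j + 1) k
      (y.comp hs.extClass (rfl : j + 1 + 1 = j + 1 + 1))
    refine ⟨l, hl, ?_⟩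
    refine Ext.covariant_sequence_exact₃ _ hs (transition a _ (j + 1) k l hl y) rfl ?_
    exact (Ext.comp_assoc (Ext.mk₀ (quotPow a hl)) y hs.extClass (zero_add _) rfl
      (by lia)).trans hy

/-- An `a`-torsion-free module is the kernel of a surjection from a module without extensions by
`R ⧸ a ^ k`. -/
lemma exists_shortExact_of_torsionGamma_eq_bot [IsNoetherianRing R] {F : ModuleCat.{u} R}
    (hF : torsionGamma a F = ⊥) :
    ∃ (E L : ModuleCat.{u} R) (f : F ⟶ E) (g : E ⟶ L) (w : f ≫ g = 0),
      (ShortComplex.mk f g w).ShortExact ∧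
        ∀ (k j : ℕ) (x : Abelian.Ext (ModuleCat.of R (R ⧸ a ^ k)) E j), x = 0 := by
  let I : ModuleCat.{u} R := Injective.under F
  have hI : Module.Injective R I :=
    (Module.injective_iff_injective_object R _).2 (inferInstanceAs (Injective (Injective.under F)))
  have hι : Function.Injective (Injective.ι F).hom := (ModuleCat.mono_iff_injective _).1 inferInstance
  let φ : F →ₗ[R] I ⧸ torsionGamma a I := (torsionGamma a I).mkQ ∘ₗ (Injective.ι F).hom
  have hφ : Function.Injective φ := by
    rw [injective_iff_map_eq_zero]
    intro x hx
    have hx' : (Injective.ι F).hom x ∈ torsionGamma a I := by simpa [φ] using hx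
    obtain ⟨k, hk⟩ := mem_torsionGamma_iff.1 hx'
    have : x ∈ torsionGamma a F := mem_torsionGamma_iff.2 ⟨k, fun r hr ↦ hι (by
      rw [map_smul, hk r hr, map_zero])⟩
    simpa [hF] using this
  refine ⟨_, _, _, _, _, cokernelComplex_shortExact φ hφ, fun k j x ↦ ?_⟩
  cases j with
  | zero => exact ext_quotPow_zero_eq_zero torsionGamma_quotient x
  | succ j =>
    have : Injective (quotientComplex (torsionGamma a I)).X₁ :=
      (Module.injective_iff_injective_object R _).1 (injective_torsionGamma hI)
    have : Injective (quotientComplex (torsionGamma a I)).X₂ :=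
      (Module.injective_iff_injective_object R _).1 hI
    obtain ⟨y, rfl⟩ := Ext.covariant_sequence_exact₃ _
      (quotientComplex_shortExact (torsionGamma a I)) x rfl (Ext.eq_zero_of_injective _)
    rw [Ext.eq_zero_of_injective y, Ext.zero_comp]

lemma comp_extClass_bijective {C : ShortComplex (ModuleCat.{u} R)} (hC : C.ShortExact)
    {X : ModuleCat.{u} R} (h : ∀ (j : ℕ) (x : Abelian.Ext X C.X₂ j), x = 0) (j : ℕ) :
    Function.Bijective (hC.extClass.postcompOfLinear R X (rfl : j + 1 = j + 1)) := by
  constructor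
  · rw [injective_iff_map_eq_zero]
    intro x hx
    obtain ⟨y, rfl⟩ := Ext.covariant_sequence_exact₃ _ hC x rfl hx
    rw [h _ y, Ext.zero_comp]
  · intro y
    exact Ext.covariant_sequence_exact₁ _ hC y (h _ _) rfl

/-- Dimension shifting for torsion-free modules. -/
lemma exists_shift [IsNoetherianRing R] {F : ModuleCat.{u} R} (hF : torsionGamma a F = ⊥) :
    ∃ L : ModuleCat.{u} R, ∀ j : ℕ, Nonempty (ExtLimit a j L ≃ₗ[R] ExtLimit a (j + 1) F) ∧
      ∀ k : ℕ, Nonempty (Abelian.Ext (ModuleCat.of R (R ⧸ a ^ k)) L j ≃ₗ[R]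
        Abelian.Ext (ModuleCat.of R (R ⧸ a ^ k)) F (j + 1)) := by
  obtain ⟨E, L, f, g, w, hs, hE⟩ := exists_shortExact_of_torsionGamma_eq_bot hF
  refine ⟨L, fun j ↦ ⟨⟨LinearEquiv.ofBijective (extLimitMap a hs.extClass rfl)
    (extLimitMap_bijective _ _ (fun k x hx ↦ ⟨k, le_rfl, ?_⟩) fun k y ↦ ⟨k, le_rfl, ?_⟩)⟩,
    fun k ↦ ⟨LinearEquiv.ofBijective _ (comp_extClass_bijective hs (hE k) j)⟩⟩⟩
  · rw [(injective_iff_map_eq_zero _).1 (comp_extClass_bijective hs (hE k) j).1 x hx, map_zero]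
  · exact (comp_extClass_bijective hs (hE k) j).2 _

end DimensionShifting

section SerreInduction

variable {a : Ideal R} {S : ModuleCat.{u} R → Prop}

lemma serre_ext_iff_quotient [IsNoetherianRing R] (hS : IsSerreClass S) (N : ModuleCat.{u} R)
    (h : S (ModuleCat.of R (torsionGamma a N))) (j : ℕ) :
    S (ModuleCat.of R (Abelian.Ext (ModuleCat.of R (R ⧸ a ^ 1)) N j)) ↔
      S (ModuleCat.of R (Abelian.Ext (ModuleCat.of R (R ⧸ a ^ 1))
        (ModuleCat.of R (N ⧸ torsionGamma a N)) j)) := by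
  have hs := quotientComplex_shortExact (torsionGamma a N)
  have hT := hS.ext (ModuleCat.of R (R ⧸ a ^ 1)) _ h
  constructor
  · intro hN
    exact hS.of_exact_s18
      ((Ext.mk₀ (quotientComplex (torsionGamma a N)).g).postcompOfLinear R _ (add_zero j))
      (hs.extClass.postcompOfLinear R _ rfl)
      (fun x hx ↦ Ext.covariant_sequence_exact₃ _ hs x rfl hx) hN (hT (j + 1))
  · intro hN
    exact hS.of_exact_s18
      ((Ext.mk₀ (quotientComplex (torsionGamma a N)).f).postcompOfLinear R _ (add_zero j))
      ((Ext.mk₀ (quotientComplex (torsionGamma a N)).g).postcompOfLinear R _ (add_zero j))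
      (fun x hx ↦ Ext.covariant_sequence_exact₂ _ hs x hx) (hT j) hN

lemma serre_ext_zero_of_torsionGamma [IsNoetherianRing R] (hS : IsSerreClass S)
    (N : ModuleCat.{u} R) (h : S (ModuleCat.of R (torsionGamma a N))) :
    S (ModuleCat.of R (Abelian.Ext (ModuleCat.of R (R ⧸ a ^ 1)) N 0)) := by
  refine (serre_ext_iff_quotient hS N h 0).2 (hS.zero _ ⟨fun x y ↦ ?_⟩)
  exact (ext_quotPow_zero_eq_zero torsionGamma_quotient x).trans
    (ext_quotPow_zero_eq_zero torsionGamma_quotient y).symm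

lemma serre_torsionGamma_of_ext_zero (hS : IsSerreClass S) (hC : CCond S a)
    (N : ModuleCat.{u} R)
    (h : S (ModuleCat.of R (Abelian.Ext (ModuleCat.of R (R ⧸ a ^ 1)) N 0))) :
    S (ModuleCat.of R (torsionGamma a N)) := by
  refine hC _ torsionGamma_torsionGamma ?_
  have h' := hS.of_surjective_s18 _ (evalOne a N 1).surjective_rangeRestrict h
  refine hS.of_injective_s18 (LinearMap.codRestrict (LinearMap.range (evalOne a N 1))
    ((torsionGamma a N).subtype ∘ₗ Submodule.subtype _) fun x ↦ exists_evalOne_eq fun r hr ↦ ?_)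
    (fun x y hxy ↦ Subtype.ext (Subtype.ext (congrArg
      (fun z : LinearMap.range (evalOne a N 1) ↦ z.1) hxy))) h'
  rw [pow_one] at hr
  exact congrArg Subtype.val ((Submodule.mem_torsionBySet_iff _ _).1 x.2 ⟨r, hr⟩)

/-- If the local cohomology modules up to degree `n` lie in a Serre subcategory, then so do the
modules `Ext(R ⧸ a, N)` up to degree `n`. -/
lemma serre_ext_of_serre_extLimit [IsNoetherianRing R] (hS : IsSerreClass S) (n : ℕ)
    (N : ModuleCat.{u} R) (h : ∀ j ≤ n, S (ModuleCat.of R (ExtLimit a j N))) :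
    ∀ j ≤ n, S (ModuleCat.of R (Abelian.Ext (ModuleCat.of R (R ⧸ a ^ 1)) N j)) := by
  induction n generalizing N with
  | zero =>
    intro j hj
    obtain rfl : j = 0 := by lia
    obtain ⟨e⟩ := exists_extLimit_zero_equiv a N
    exact serre_ext_zero_of_torsionGamma hS N (hS.of_equiv_s18 e (h 0 le_rfl))
  | succ n ih =>
    obtain ⟨e⟩ := exists_extLimit_zero_equiv a N
    have hT := hS.of_equiv_s18 e (h 0 (by lia))
    rintro (_ | j) hj
    · exact serre_ext_zero_of_torsionGamma hS N hT
    · obtain ⟨L, hL⟩ := exists_shift (F := ModuleCat.of R (N ⧸ torsionGamma a N))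
        torsionGamma_quotient
      refine (serre_ext_iff_quotient hS N hT _).2 ?_
      obtain ⟨e⟩ := (hL j).2 1
      refine hS.of_equiv_s18 e (ih L (fun i hi ↦ ?_) j (by lia))
      obtain ⟨e₁⟩ := (hL i).1
      obtain ⟨e₂⟩ := exists_extLimit_quotient_equiv a N i
      exact hS.of_equiv_s18 (e₂.trans e₁.symm) (h (i + 1) (by lia))

/-- If a Serre subcategory satisfies the `C_a` condition and contains the modules `Ext(R ⧸ a, N)`
up to degree `n`, then it contains the local cohomology modules up to degree `n`. -/
lemma serre_extLimit_of_serre_ext [IsNoetherianRing R] (hS : IsSerreClass S) (hC : CCond S a)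
    (n : ℕ) (N : ModuleCat.{u} R)
    (h : ∀ j ≤ n, S (ModuleCat.of R (Abelian.Ext (ModuleCat.of R (R ⧸ a ^ 1)) N j))) :
    ∀ j ≤ n, S (ModuleCat.of R (ExtLimit a j N)) := by
  induction n generalizing N with
  | zero =>
    intro j hj
    obtain rfl : j = 0 := by lia
    obtain ⟨e⟩ := exists_extLimit_zero_equiv a N
    exact hS.of_equiv_s18 e.symm (serre_torsionGamma_of_ext_zero hS hC N (h 0 le_rfl))
  | succ n ih =>
    have hT := serre_torsionGamma_of_ext_zero hS hC N (h 0 (by lia))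
    rintro (_ | j) hj
    · obtain ⟨e⟩ := exists_extLimit_zero_equiv a N
      exact hS.of_equiv_s18 e.symm hT
    · obtain ⟨L, hL⟩ := exists_shift (F := ModuleCat.of R (N ⧸ torsionGamma a N))
        torsionGamma_quotient
      obtain ⟨e₁⟩ := (hL j).1
      obtain ⟨e₂⟩ := exists_extLimit_quotient_equiv a N j
      refine hS.of_equiv_s18 (e₁.trans e₂.symm) (ih L (fun i hi ↦ ?_) j (by lia))
      obtain ⟨e⟩ := (hL i).2 1
      exact hS.of_equiv_s18 e.symm ((serre_ext_iff_quotient hS N hT _).1 (h (i + 1) (by lia)))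

end SerreInduction

section Support

lemma isSerreClass_support_subset (Z : Set (PrimeSpectrum R)) :
    IsSerreClass (fun N : ModuleCat.{u} R ↦ Module.support R N ⊆ Z) where
  iso _ _ e h := (LinearEquiv.support_eq e).ge.trans h
  zero N _ := by simp [Module.support_eq_empty]
  subobj N P h := (Module.support_subset_of_injective P.subtype P.subtype_injective).trans h
  quot N P h := (Module.support_subset_of_surjective P.mkQ P.mkQ_surjective).trans h
  extension N P hP hQ := by
    have := Module.support_of_exact (LinearMap.exact_subtype_mkQ P) P.subtype_injective
      P.mkQ_surjective
    rw [this]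
    exact Set.union_subset hP hQ

/-- A finitely generated module supported at maximal ideals is artinian. -/
lemma isArtinian_of_support_isMaximal [IsNoetherianRing R] (N : Type u) [AddCommGroup N]
    [Module R N] [Module.Finite R N] (h : ∀ p ∈ Module.support R N, p.asIdeal.IsMaximal) :
    IsArtinian R N := by
  induction ‹Module.Finite R N› using
    IsNoetherianRing.induction_on_isQuotientEquivQuotientPrime R with
  | subsingleton N => infer_instance
  | quotient N p e =>
    have : p.asIdeal.IsMaximal := h p (by
      rw [e.support_eq, Module.support_eq_zeroLocus]
      simp [Ideal.annihilator_quotient])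
    have : IsSimpleModule R (R ⧸ p.asIdeal) := isSimpleModule_iff_isCoatom.2 this.out
    exact isArtinian_of_linearEquiv e.symm
  | exact N₁ N₂ N₃ f g hf hg hfg h₁ h₃ =>
    rw [Module.support_of_exact hfg hf hg] at h
    have := h₁ fun p hp ↦ h p (Or.inl hp)
    have := h₃ fun p hp ↦ h p (Or.inr hp)
    exact isArtinian_of_range_eq_ker f g (LinearMap.exact_iff.1 hfg).symm

end Support

end LocalCohomologySerre

/-- Let `S` be a Serre subcategory satisfying `C_a` and containing every finite length
module, and let `M` be finitely generated with `Supp H^i_a(M) ⊆ {m₁, …, m_t}` (maximal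
ideals) for all `i ≤ n`. Then `H^i_a(M) ∈ S` for all `i ≤ n`. -/
theorem stmt18 [IsNoetherianRing R] (a : Ideal R)
    (t : ℕ) (m : Fin t → Ideal R) (hm : ∀ j, (m j).IsMaximal)
    (S : ModuleCat.{u} R → Prop)
    (hS : IsSerreClass S)
    (hC : CCond S a)
    (hfl : ∀ M : ModuleCat.{u} R, IsNoetherian R M → IsArtinian R M → S M)
    (M : ModuleCat.{u} R) (hfin : Module.Finite R M) (n : ℕ)
    (hsupp : ∀ i ≤ n, Module.support R ((localCohomology a i).obj M) ⊆
      {p : PrimeSpectrum R | ∃ j, p.asIdeal = m j}) :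
    ∀ i ≤ n, S ((localCohomology a i).obj M) := by
  have hext := LocalCohomologySerre.serre_ext_of_serre_extLimit
    (LocalCohomologySerre.isSerreClass_support_subset {p : PrimeSpectrum R | ∃ j, p.asIdeal = m j})
    n M (fun i hi ↦ (LocalCohomologySerre.extLimitEquiv a i M).support_eq.le.trans (hsupp i hi))
  have hlim := LocalCohomologySerre.serre_extLimit_of_serre_ext hS hC n M fun i hi ↦
    hfl _ inferInstance (LocalCohomologySerre.isArtinian_of_support_isMaximal _ fun p hp ↦ by
      obtain ⟨j, hj⟩ := hext i hi hp
      exact hj ▸ hm j)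
  exact fun i hi ↦ hS.of_equiv_s18 (LocalCohomologySerre.extLimitEquiv a i M) (hlim i hi)
end

section
/- Let (R, 𝔪) be a commutative noetherian local ring, let 𝔞 be an ideal of R, and let 𝒮 be a Serre subcategory of R-modules that satisfies the C_𝔞 condition and contains every R-module of finite length. If M is a nonzero finitely generated R-module of Krull dimension n (i.e. the Krull dimension of R/Ann_R(M) equals n), then the local cohomology module H^n_𝔞(M) belongs to 𝒮. -/
universe u

open Submodule

variable {R : Type u} [CommRing R]

namespace LocalCohomologyAux

open CategoryTheory Limits Abelian

noncomputable section

/-- The complex in the opposite category whose homology computes the functor `Ext`. -/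
abbrev opComplex (Y : ModuleCat.{u} R) {X : ModuleCat.{u} R} (P : ProjectiveResolution X) :
    ChainComplex (ModuleCat.{u} R)ᵒᵖ ℕ :=
  (((linearYoneda R (ModuleCat.{u} R)).obj Y).rightOp.mapHomologicalComplex _).obj P.complex

/-- The isomorphism computing the derived functor `Ext` from a projective resolution. -/
def opExtIso (Y : ModuleCat.{u} R) {X : ModuleCat.{u} R} (P : ProjectiveResolution X) (n : ℕ) :
    (((linearYoneda R (ModuleCat.{u} R)).obj Y).rightOp.leftDerived n).obj X ≅
      (opComplex Y P).homology n :=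
  P.isoLeftDerivedObj ((linearYoneda R (ModuleCat.{u} R)).obj Y).rightOp n

/-- The inclusion of the cocycles in degree `n`. -/
def cocycleι (Y : ModuleCat.{u} R) {X : ModuleCat.{u} R} (P : ProjectiveResolution X) (n : ℕ) :
    ((opComplex Y P).opcycles n).unop →ₗ[R] (P.complex.X n ⟶ Y) :=
  ((opComplex Y P).pOpcycles n).unop.hom

/-- The projection of the cocycles onto `Ext`. -/
def cocycleπ (Y : ModuleCat.{u} R) {X : ModuleCat.{u} R} (P : ProjectiveResolution X) (n : ℕ) :
    ((opComplex Y P).opcycles n).unop →ₗ[R]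
      ((Ext R (ModuleCat.{u} R) n).obj (Opposite.op X)).obj Y :=
  ((opExtIso Y P n).hom ≫ (opComplex Y P).homologyι n).unop.hom

variable (Y : ModuleCat.{u} R) {X : ModuleCat.{u} R} (P : ProjectiveResolution X) (n : ℕ)

lemma cocycleι_injective : Function.Injective (cocycleι Y P n) :=
  (ModuleCat.mono_iff_injective _).mp
    (inferInstance : Mono ((opComplex Y P).pOpcycles n).unop)

lemma cocycleπ_surjective : Function.Surjective (cocycleπ Y P n) :=
  (ModuleCat.epi_iff_surjective
    ((opExtIso Y P n).hom ≫ (opComplex Y P).homologyι n).unop).mp inferInstance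

lemma d_comp_cocycleι (z : ((opComplex Y P).opcycles n).unop) :
    P.complex.d (n + 1) n ≫ cocycleι Y P n z = 0 := by
  have := congrArg Quiver.Hom.unop ((opComplex Y P).d_pOpcycles (n + 1) n)
  exact congrArg (fun f => f.hom z) this

lemma exists_cocycleι_eq (f : P.complex.X n ⟶ Y) (hf : P.complex.d (n + 1) n ≫ f = 0) :
    ∃ z, cocycleι Y P n z = f := by
  have h := (ShortComplex.exact_of_g_is_cokernel
    (ShortComplex.mk _ _ ((opComplex Y P).d_pOpcycles (n + 1) n))
    ((opComplex Y P).opcyclesIsCokernel (n + 1) n (by simp))).unop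
  rw [ShortComplex.moduleCat_exact_iff] at h
  exact h f hf

lemma cocycleπ_eq_zero_iff_succ (z : ((opComplex Y P).opcycles (n + 1)).unop) :
    cocycleπ Y P (n + 1) z = 0 ↔
      ∃ g : P.complex.X n ⟶ Y, P.complex.d (n + 1) n ≫ g = cocycleι Y P (n + 1) z := by
  have e : ∀ x, cocycleι Y P (n + 1) (((opComplex Y P).fromOpcycles (n + 1) n).unop.hom x) =
      P.complex.d (n + 1) n ≫ x := by
    intro x
    have := congrArg Quiver.Hom.unop ((opComplex Y P).p_fromOpcycles (n + 1) n)
    exact congrArg (fun f => f.hom x) this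
  have h := (ShortComplex.exact_of_f_is_kernel
    (ShortComplex.mk _ _ ((opComplex Y P).homologyι_comp_fromOpcycles (n + 1) n))
    ((opComplex Y P).homologyIsKernel (n + 1) n (by simp))).unop
  rw [ShortComplex.moduleCat_exact_iff] at h
  have hz : cocycleπ Y P (n + 1) z = 0 ↔ ((opComplex Y P).homologyι (n + 1)).unop.hom z = 0 := by
    have inj : Function.Injective (opExtIso Y P (n + 1)).hom.unop.hom :=
      (ModuleCat.mono_iff_injective _).mp inferInstance
    exact map_eq_zero_iff _ inj
  rw [hz]
  constructor
  · intro h0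
    obtain ⟨x, hx⟩ := h z h0
    exact ⟨x, (e x).symm.trans (congrArg _ hx)⟩
  · rintro ⟨g, hg⟩
    rw [← cocycleι_injective Y P (n + 1) ((e g).trans hg)]
    have := congrArg Quiver.Hom.unop ((opComplex Y P).homologyι_comp_fromOpcycles (n + 1) n)
    exact congrArg (fun f => f.hom g) this

lemma cocycleπ_zero_eq_zero_iff (z : ((opComplex Y P).opcycles 0).unop) :
    cocycleπ Y P 0 z = 0 ↔ z = 0 := by
  have inj : Function.Injective (cocycleπ Y P 0) :=
    (ModuleCat.mono_iff_injective
      ((opExtIso Y P 0).hom ≫ (opComplex Y P).homologyι 0).unop).mp inferInstance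
  exact map_eq_zero_iff _ inj

lemma extMk_zero_eq_zero_iff (f : P.complex.X 0 ⟶ Y) (hf : P.complex.d 1 0 ≫ f = 0) :
    P.extMk f 1 rfl hf = 0 ↔ f = 0 := by
  refine ⟨fun h => ?_, fun h => by subst h; simp⟩
  rw [← P.extEquivCohomologyClass.apply_eq_iff_eq,
    ProjectiveResolution.extEquivCohomologyClass_extMk,
    ProjectiveResolution.extEquivCohomologyClass_zero,
    CochainComplex.HomComplex.CohomologyClass.mk_eq_zero_iff,
    CochainComplex.HomComplex.Cocycle.toSingleMk_mem_coboundaries_iff _ _ _ _ _ 1 (by simp)] at h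
  obtain ⟨g, hg⟩ := h
  have : P.cochainComplex.d (-(0 : ℕ)) 1 = 0 := by
    apply IsZero.eq_of_tgt
    exact P.cochainComplex.isZero_of_isStrictlyLE 0 1 
  rw [this, zero_comp] at hg
  simpa using hg.symm

variable {Y} in
lemma extMk_congr {n : ℕ} {f f' : P.complex.X n ⟶ Y} (h : f = f')
    (hf : P.complex.d (n + 1) n ≫ f = 0) (hf' : P.complex.d (n + 1) n ≫ f' = 0) :
    P.extMk f (n + 1) rfl hf = P.extMk f' (n + 1) rfl hf' := by
  subst h; rfl

/-- The comparison map from cocycles to `Abelian.Ext`. -/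
def cocycleToExt : ((opComplex Y P).opcycles n).unop →ₗ[R] Abelian.Ext X Y n where
  toFun z := P.extMk (cocycleι Y P n z) (n + 1) rfl (d_comp_cocycleι Y P n z)
  map_add' x y := by
    rw [P.add_extMk]
    simp only [map_add]
  map_smul' r x := by
    rw [RingHom.id_apply, Ext.smul_eq_comp_mk₀, P.extMk_comp_mk₀]
    simp only [map_smul, Linear.comp_smul, Category.comp_id]

lemma cocycleToExt_surjective : Function.Surjective (cocycleToExt Y P n) := by
  intro e
  obtain ⟨f, hf, rfl⟩ := P.extMk_surjective e (n + 1) rfl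
  obtain ⟨z, rfl⟩ := exists_cocycleι_eq Y P n f hf
  exact ⟨z, rfl⟩

lemma ker_cocycleToExt :
    LinearMap.ker (cocycleToExt Y P n) = LinearMap.ker (cocycleπ Y P n) := by
  ext z
  rw [LinearMap.mem_ker, LinearMap.mem_ker]
  cases n with
  | zero =>
    rw [cocycleπ_zero_eq_zero_iff]
    exact (extMk_zero_eq_zero_iff Y P _ (d_comp_cocycleι Y P 0 z)).trans (map_eq_zero_iff _ (cocycleι_injective Y P 0))
  | succ n =>
    rw [cocycleπ_eq_zero_iff_succ]
    exact P.extMk_eq_zero_iff _ _ rfl (d_comp_cocycleι Y P (n + 1) z) n rfl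

/-- The comparison isomorphism between the two models of `Ext`. -/
def extComparison :
    ((Ext R (ModuleCat.{u} R) n).obj (Opposite.op X)).obj Y ≃ₗ[R] Abelian.Ext X Y n :=
  ((cocycleπ Y P n).quotKerEquivOfSurjective (cocycleπ_surjective Y P n)).symm ≪≫ₗ
    Submodule.quotEquivOfEq _ _ (ker_cocycleToExt Y P n).symm ≪≫ₗ
    (cocycleToExt Y P n).quotKerEquivOfSurjective (cocycleToExt_surjective Y P n)

lemma extComparison_cocycleπ (z : ((opComplex Y P).opcycles n).unop) :
    extComparison Y P n (cocycleπ Y P n z) = cocycleToExt Y P n z := by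
  have : ((cocycleπ Y P n).quotKerEquivOfSurjective (cocycleπ_surjective Y P n)).symm
      (cocycleπ Y P n z) = Submodule.Quotient.mk z := by
    rw [LinearEquiv.symm_apply_eq]; rfl
  simp only [extComparison, LinearEquiv.trans_apply, this]
  rfl

variable {X' : ModuleCat.{u} R} (P' : ProjectiveResolution X')

lemma extComparison_naturality (g : X' ⟶ X)
    (x : ((Ext R (ModuleCat.{u} R) n).obj (Opposite.op X)).obj Y) :
    extComparison Y P' n ((((Ext R (ModuleCat.{u} R) n).map g.op).app Y).hom x) =
      (Abelian.Ext.mk₀ g).comp (extComparison Y P n x) (zero_add n) := by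
  obtain ⟨z, rfl⟩ := cocycleπ_surjective Y P n x
  let φ : ProjectiveResolution.Hom P' P g :=
    ⟨ProjectiveResolution.lift g P' P, ProjectiveResolution.lift_commutes_zero g P' P⟩
  let ψ := (((linearYoneda R (ModuleCat.{u} R)).obj Y).rightOp.mapHomologicalComplex _).map φ.hom
  let z' : ((opComplex Y P').opcycles n).unop :=
    (HomologicalComplex.opcyclesMap ψ n).unop.hom z
  have hz' : cocycleι Y P' n z' = φ.hom.f n ≫ cocycleι Y P n z := by
    have := congrArg Quiver.Hom.unop (HomologicalComplex.p_opcyclesMap ψ n)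
    exact congrArg (fun f => f.hom z) this
  have hπ : (((Ext R (ModuleCat.{u} R) n).map g.op).app Y).hom (cocycleπ Y P n z) =
      cocycleπ Y P' n z' := by
    have h1 : (((linearYoneda R (ModuleCat.{u} R)).obj Y).rightOp.leftDerived n).map g ≫
        (opExtIso Y P n).hom = (opExtIso Y P' n).hom ≫ HomologicalComplex.homologyMap ψ n :=
      P'.isoLeftDerivedObj_hom_naturality g P φ.hom
        (ProjectiveResolution.lift_commutes_zero g P' P)
        ((linearYoneda R (ModuleCat.{u} R)).obj Y).rightOp n
    have h2 := HomologicalComplex.homologyι_naturality ψ n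
    have h3 := h1 =≫ (opComplex Y P).homologyι n
    rw [Category.assoc, Category.assoc] at h3
    have h4 := h3.trans (congrArg _ h2)
    have := congrArg Quiver.Hom.unop h4
    exact congrArg (fun f => f.hom z) this
  rw [hπ, extComparison_cocycleπ, extComparison_cocycleπ]
  refine Eq.trans ?_ (ProjectiveResolution.mk₀_comp_extMk (cocycleι Y P n z) (n + 1) rfl
    (d_comp_cocycleι Y P n z) φ).symm
  exact extMk_congr P' hz' (d_comp_cocycleι Y P' n z')
    (by rw [← φ.hom.comm_assoc, d_comp_cocycleι, comp_zero])

/-- The contravariant functor `Extⁿ(-, Y)`. -/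
def extFunctor (Y : ModuleCat.{u} R) (n : ℕ) : (ModuleCat.{u} R)ᵒᵖ ⥤ ModuleCat.{u} R where
  obj X := ModuleCat.of R (Abelian.Ext X.unop Y n)
  map g := ModuleCat.ofHom ((Abelian.Ext.mk₀ g.unop).precompOfLinear R Y (zero_add n))
  map_id X := by
    ext e
    exact Abelian.Ext.mk₀_id_comp e
  map_comp f g := by
    ext e
    exact (Abelian.Ext.mk₀_comp_mk₀_assoc _ _ e).symm

/-- The two models of `Ext` define isomorphic functors. -/
def extFunctorIso (Y : ModuleCat.{u} R) (n : ℕ) :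
    (Ext R (ModuleCat.{u} R) n).flip.obj Y ≅ extFunctor Y n :=
  NatIso.ofComponents
    (fun X => (extComparison Y (projectiveResolution X.unop) n).toModuleIso)
    (fun {X X'} g => by
      ext x
      exact extComparison_naturality Y (projectiveResolution X.unop) n
        (projectiveResolution X'.unop) g.unop x)

end

noncomputable section

variable (a : Ideal R)

/-- Postcomposition with a class in `Ext`, as a natural transformation. -/
def extPostcomp {Y Z : ModuleCat.{u} R} {p n m : ℕ} (α : Abelian.Ext Y Z p) (h : n + p = m) :
    extFunctor Y n ⟶ extFunctor Z m where
  app X := ModuleCat.ofHom (α.postcompOfLinear R X.unop h)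
  naturality X X' g := by
    ext e
    exact Abelian.Ext.comp_assoc (Abelian.Ext.mk₀ g.unop) e α (zero_add n) h (by lia)

/-- The directed system of the modules `Extⁿ(R/aᵗ, M)`. -/
def powersExt (M : ModuleCat.{u} R) (n : ℕ) : (ℕᵒᵖ)ᵒᵖ ⥤ ModuleCat.{u} R :=
  (localCohomology.ringModIdeals (localCohomology.idealPowersDiagram a)).op ⋙ extFunctor M n

/-- Local cohomology as the colimit of the modules `Extⁿ(R/aᵗ, M)`. -/
def locCoh (M : ModuleCat.{u} R) (n : ℕ) : ModuleCat.{u} R :=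
  colimit (powersExt a M n)

/-- The comparison with local cohomology as defined in Mathlib. -/
def locCohIso (M : ModuleCat.{u} R) (n : ℕ) : (localCohomology a n).obj M ≅ locCoh a M n :=
  colimitObjIsoColimitCompEvaluation
      (localCohomology.diagram (localCohomology.idealPowersDiagram a) n) M ≪≫
    HasColimit.isoOfNatIso (Functor.isoWhiskerLeft
      (localCohomology.ringModIdeals (localCohomology.idealPowersDiagram a)).op
      (extFunctorIso M n))

/-- The module `R/aᵗ`. -/
abbrev quotPow (t : ℕ) : ModuleCat.{u} R := ModuleCat.of R (R ⧸ a ^ t)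

variable {a} in
/-- The projection `R/aˢ → R/aᵗ` for `t ≤ s`. -/
def quotPowMap {s t : ℕ} (h : t ≤ s) : quotPow a s ⟶ quotPow a t :=
  ModuleCat.ofHom (Submodule.mapQ _ _ LinearMap.id (Ideal.pow_le_pow_right h))

variable {a}

/-- The class in local cohomology of an element of `Extⁿ(R/aᵗ, M)`. -/
def toLocCoh {M : ModuleCat.{u} R} {n : ℕ} (t : ℕ) :
    Abelian.Ext (quotPow a t) M n →ₗ[R] locCoh a M n :=
  (colimit.ι (powersExt a M n) (Opposite.op (Opposite.op t))).hom

instance : PreservesFilteredColimitsOfSize.{0, 0} (forget (ModuleCat.{u} R)) :=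
  preservesFilteredColimitsOfSize_shrink.{0, u, 0, u} _

variable {M Y Z W : ModuleCat.{u} R} {n m p q l : ℕ}

lemma exists_toLocCoh (x : locCoh a M n) :
    ∃ (t : ℕ) (e : Abelian.Ext (quotPow a t) M n), toLocCoh t e = x := by
  obtain ⟨j, y, h⟩ := Concrete.colimit_exists_rep (powersExt a M n) x
  exact ⟨j.unop.unop, y, h⟩

lemma toLocCoh_quotPowMap {s t : ℕ} (h : t ≤ s) (e : Abelian.Ext (quotPow a t) M n) :
    toLocCoh s ((Abelian.Ext.mk₀ (quotPowMap h)).comp e (zero_add n)) = toLocCoh t e := by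
  have := colimit.w (powersExt a M n)
    (show Opposite.op (Opposite.op t) ⟶ Opposite.op (Opposite.op s) from (homOfLE h).op.op)
  exact congrArg (fun f => f.hom e) this

lemma toLocCoh_eq_zero {t : ℕ} {e : Abelian.Ext (quotPow a t) M n} (he : toLocCoh t e = 0) :
    ∃ (s : ℕ) (h : t ≤ s), (Abelian.Ext.mk₀ (quotPowMap h)).comp e (zero_add n) = 0 := by
  obtain ⟨j, i, h⟩ := Concrete.colimit_rep_eq_zero R (powersExt a M n)
    (Opposite.op (Opposite.op t)) e he
  exact ⟨j.unop.unop, i.unop.unop.down.down, h⟩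

/-- The map induced on local cohomology by a class in `Ext`. -/
def locCohMap (α : Abelian.Ext Y Z p) (h : n + p = m) : locCoh a Y n →ₗ[R] locCoh a Z m :=
  (colimMap (Functor.whiskerLeft
    (localCohomology.ringModIdeals (localCohomology.idealPowersDiagram a)).op
      (extPostcomp α h))).hom

lemma locCohMap_toLocCoh (α : Abelian.Ext Y Z p) (h : n + p = m) (t : ℕ)
    (e : Abelian.Ext (quotPow a t) Y n) :
    locCohMap α h (toLocCoh t e) = toLocCoh t (e.comp α h) := by
  have := ι_colimMap (Functor.whiskerLeft
    (localCohomology.ringModIdeals (localCohomology.idealPowersDiagram a)).op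
      (extPostcomp α h)) (Opposite.op (Opposite.op t))
  exact congrArg (fun f => f.hom e) this

lemma exists_locCohMap_eq (α : Abelian.Ext Y Z p) (h : n + p = m) (β : Abelian.Ext Z W q)
    (h' : m + q = l)
    (H : ∀ (X : ModuleCat.{u} R) (e : Abelian.Ext X Z m), e.comp β h' = 0 →
      ∃ e' : Abelian.Ext X Y n, e'.comp α h = e)
    (x : locCoh a Z m) (hx : locCohMap β h' x = 0) : ∃ y, locCohMap α h y = x := by
  obtain ⟨t, e, rfl⟩ := exists_toLocCoh x
  rw [locCohMap_toLocCoh] at hx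
  obtain ⟨s, hs, hs'⟩ := toLocCoh_eq_zero hx
  rw [← Abelian.Ext.comp_assoc _ _ _ (zero_add m) h' (by lia)] at hs'
  obtain ⟨e', he'⟩ := H _ _ hs'
  refine ⟨toLocCoh s e', ?_⟩
  rw [locCohMap_toLocCoh, he', toLocCoh_quotPowMap]

lemma smul_quotPow_id {t : ℕ} {r : R} (hr : r ∈ a ^ t) : r • 𝟙 (quotPow a t) = 0 := by
  ext
  change Submodule.Quotient.mk (r • (1 : R)) = 0
  rw [Submodule.Quotient.mk_eq_zero]
  exact Ideal.mul_mem_right _ _ hr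

lemma smul_ext_quotPow_eq_zero {t : ℕ} {r : R} (hr : r ∈ a ^ t)
    (e : Abelian.Ext (quotPow a t) M n) : r • e = 0 := by
  have : r • e = (Abelian.Ext.mk₀ (r • 𝟙 (quotPow a t))).comp e (zero_add n) := by
    rw [Abelian.Ext.mk₀_smul, Abelian.Ext.smul_comp, Abelian.Ext.mk₀_id_comp]
  rw [this, smul_quotPow_id hr, Abelian.Ext.mk₀_zero, Abelian.Ext.zero_comp]

lemma exists_forall_smul_eq_zero (x : locCoh a M n) : ∃ t : ℕ, ∀ r ∈ a ^ t, r • x = 0 := by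
  obtain ⟨t, e, rfl⟩ := exists_toLocCoh x
  refine ⟨t, fun r hr => ?_⟩
  rw [← map_smul, smul_ext_quotPow_eq_zero hr, map_zero]

lemma locCohMap_smul_id (r : R) (x : locCoh a M n) :
    locCohMap (Abelian.Ext.mk₀ (r • 𝟙 M)) (add_zero n) x = r • x := by
  obtain ⟨t, e, rfl⟩ := exists_toLocCoh x
  rw [locCohMap_toLocCoh, ← map_smul, Abelian.Ext.smul_eq_comp_mk₀]

/-- Evaluation at `1` of the homomorphism corresponding to a class in degree zero. -/
def evalOne (t : ℕ) : Abelian.Ext (quotPow a t) M 0 →ₗ[R] M where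
  toFun e := (Abelian.Ext.homEquiv₀ e).hom (Submodule.Quotient.mk 1)
  map_add' e e' := by
    have : Abelian.Ext.homEquiv₀ (e + e') =
        Abelian.Ext.homEquiv₀ e + Abelian.Ext.homEquiv₀ e' :=
      map_add (Abelian.Ext.linearEquiv₀ (R := R)) e e'
    rw [this]
    rfl
  map_smul' r e := by
    have : Abelian.Ext.homEquiv₀ (r • e) = r • Abelian.Ext.homEquiv₀ e :=
      map_smul (Abelian.Ext.linearEquiv₀ (R := R)) r e
    rw [this]
    rfl

lemma evalOne_mk₀ (t : ℕ) (g : quotPow a t ⟶ M) :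
    evalOne t (Abelian.Ext.mk₀ g) = g.hom (Submodule.Quotient.mk 1) := by
  change (Abelian.Ext.homEquiv₀ (Abelian.Ext.homEquiv₀.symm g)).hom _ = _
  rw [Equiv.apply_symm_apply]

lemma evalOne_injective (t : ℕ) : Function.Injective (evalOne (a := a) (M := M) t) := by
  rw [injective_iff_map_eq_zero]
  intro e he
  obtain ⟨g, rfl⟩ := Abelian.Ext.homEquiv₀.symm.surjective e
  have hg : evalOne t (Abelian.Ext.mk₀ g) = 0 := he
  rw [evalOne_mk₀] at hg
  have : g = 0 := by
    ext
    exact hg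
  subst this
  exact Abelian.Ext.mk₀_zero _ _

lemma evalOne_quotPowMap {s t : ℕ} (h : t ≤ s) (e : Abelian.Ext (quotPow a t) M 0) :
    evalOne s ((Abelian.Ext.mk₀ (quotPowMap h)).comp e (zero_add 0)) = evalOne t e := by
  obtain ⟨g, rfl⟩ := Abelian.Ext.homEquiv₀.symm.surjective e
  change evalOne s ((Abelian.Ext.mk₀ (quotPowMap h)).comp (Abelian.Ext.mk₀ g) (zero_add 0)) =
    evalOne t (Abelian.Ext.mk₀ g)
  rw [Abelian.Ext.mk₀_comp_mk₀, evalOne_mk₀, evalOne_mk₀]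
  rfl

variable (a M) in
/-- The cocone given by evaluation at `1`. -/
def locCohEvalOneCocone : Cocone (powersExt a M 0) where
  pt := M
  ι :=
    { app := fun j => ModuleCat.ofHom (evalOne j.unop.unop)
      naturality := fun j j' f => by
        ext e
        exact evalOne_quotPowMap f.unop.unop.down.down e }

variable (a M) in
/-- Evaluation at `1` on local cohomology in degree zero. -/
def locCohEvalOne : locCoh a M 0 →ₗ[R] M :=
  (colimit.desc (powersExt a M 0) (locCohEvalOneCocone a M)).hom

lemma locCohEvalOne_toLocCoh (t : ℕ) (e : Abelian.Ext (quotPow a t) M 0) :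
    locCohEvalOne a M (toLocCoh t e) = evalOne t e := by
  have := colimit.ι_desc (F := powersExt a M 0) (locCohEvalOneCocone a M)
    (Opposite.op (Opposite.op t))
  exact congrArg (fun f => f.hom e) this

lemma locCohEvalOne_injective : Function.Injective (locCohEvalOne a M) := by
  rw [injective_iff_map_eq_zero]
  intro x hx
  obtain ⟨t, e, rfl⟩ := exists_toLocCoh x
  rw [locCohEvalOne_toLocCoh] at hx
  rw [evalOne_injective t (hx.trans (map_zero _).symm), map_zero]

end

noncomputable section

/-- Dimension shifting for the vanishing of precomposition on `Ext`. -/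
lemma mk₀_comp_eq_zero_of_ker {T : ModuleCat.{u} R} {n : ℕ}
    {F G X Y : Type u} [AddCommGroup F] [Module R F] [AddCommGroup G] [Module R G]
    [AddCommGroup X] [Module R X] [AddCommGroup Y] [Module R Y] [Module.Projective R F]
    {p : F →ₗ[R] Y} {q : G →ₗ[R] X} (hp : Function.Surjective p) (hq : Function.Surjective q)
    (φ : G →ₗ[R] F) (h : X →ₗ[R] Y) (comm : p ∘ₗ φ = h ∘ₗ q)
    (ψ : LinearMap.ker q →ₗ[R] LinearMap.ker p) (hψ : ∀ x, (ψ x : F) = φ x)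
    (H : ∀ e : Abelian.Ext (ModuleCat.of R (LinearMap.ker p)) T n,
      (Abelian.Ext.mk₀ (ModuleCat.ofHom ψ)).comp e (zero_add n) = 0)
    (e : Abelian.Ext (ModuleCat.of R Y) T (n + 1)) :
    (Abelian.Ext.mk₀ (ModuleCat.ofHom h)).comp e (zero_add (n + 1)) = 0 := by
  have exP := LinearMap.shortExact_shortComplexKer hp
  have exQ := LinearMap.shortExact_shortComplexKer hq
  have : Projective p.shortComplexKer.X₂ :=
    inferInstanceAs (Projective (ModuleCat.of R F))
  let f : q.shortComplexKer ⟶ p.shortComplexKer :=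
    { τ₁ := ModuleCat.ofHom ψ
      τ₂ := ModuleCat.ofHom φ
      τ₃ := ModuleCat.ofHom h
      comm₁₂ := by
        ext x
        exact hψ x
      comm₂₃ := by
        ext x
        exact LinearMap.congr_fun comm x }
  obtain ⟨e', rfl⟩ := precomp_extClass_surjective_of_projective_X₂ T exP n e
  have nat := ShortComplex.ShortExact.extClass_naturality exQ exP f
  change (Abelian.Ext.mk₀ f.τ₃).comp (exP.extClass.comp e' (add_comm 1 n)) _ = 0
  rw [← Abelian.Ext.comp_assoc _ _ _ (zero_add 1) (add_comm 1 n) (by lia), ← nat,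
    Abelian.Ext.comp_assoc _ _ _ (add_zero 1) (zero_add n) (by lia)]
  have := H e'
  change (Abelian.Ext.mk₀ f.τ₁).comp e' _ = 0 at this
  rw [this, Abelian.Ext.comp_zero]

/-- Lifting along a surjection a map from a projective module with values in `b` times
the target. -/
lemma exists_lift_mem_smul_top (b : Ideal R) {F G Y : Type u} [AddCommGroup F] [Module R F]
    [AddCommGroup G] [Module R G] [AddCommGroup Y] [Module R Y] [Module.Projective R G]
    {p : F →ₗ[R] Y} (hp : Function.Surjective p) (h : G →ₗ[R] Y)
    (hh : ∀ x, h x ∈ (b • ⊤ : Submodule R Y)) :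
    ∃ φ : G →ₗ[R] F, (∀ x, φ x ∈ (b • ⊤ : Submodule R F)) ∧ p ∘ₗ φ = h := by
  have hmap : Submodule.map p (b • ⊤) = b • ⊤ := by
    rw [Submodule.map_smul'', Submodule.map_top, LinearMap.range_eq_top.mpr hp]
  let pb : (b • ⊤ : Submodule R F) →ₗ[R] (b • ⊤ : Submodule R Y) :=
    p.restrict fun x hx => hmap ▸ Submodule.mem_map_of_mem hx
  have hpb : Function.Surjective pb := by
    rintro ⟨y, hy⟩
    have hy' := hy
    rw [← hmap] at hy'
    obtain ⟨x, hx, rfl⟩ := hy'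
    exact ⟨⟨x, hx⟩, rfl⟩
  obtain ⟨φ, hφ⟩ := Module.projective_lifting_property pb (h.codRestrict _ hh) hpb
  exact ⟨Submodule.subtype _ ∘ₗ φ, fun x => (φ x).2,
    LinearMap.ext fun x => congrArg Subtype.val (LinearMap.congr_fun hφ x)⟩

/-- If a power of `a` annihilates `T`, then maps into a sufficiently high power of `a` times
a finite module induce zero on `Ext`. -/
lemma exists_pow_forall_mk₀_comp_eq_zero [IsNoetherianRing R] {a : Ideal R}
    {T : ModuleCat.{u} R} {k : ℕ} (hT : ∀ r ∈ a ^ k, ∀ x : T, r • x = 0) (n : ℕ) :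
    ∀ (Y : Type u) [AddCommGroup Y] [Module R Y] [Module.Finite R Y],
      ∃ m : ℕ, ∀ (X : Type u) [AddCommGroup X] [Module R X] (h : X →ₗ[R] Y),
        (∀ x, h x ∈ (a ^ m • ⊤ : Submodule R Y)) →
        ∀ e : Abelian.Ext (ModuleCat.of R Y) T n,
          (Abelian.Ext.mk₀ (ModuleCat.ofHom h)).comp e (zero_add n) = 0 := by
  induction n with
  | zero =>
    intro Y _ _ _
    refine ⟨k, fun X _ _ h hh e => ?_⟩
    obtain ⟨g, rfl⟩ := Abelian.Ext.homEquiv₀.symm.surjective e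
    change (Abelian.Ext.mk₀ (ModuleCat.ofHom h)).comp (Abelian.Ext.mk₀ g) _ = 0
    have : ModuleCat.ofHom h ≫ g = 0 := by
      ext x
      change g.hom (h x) = 0
      refine Submodule.smul_induction_on (p := fun y => g.hom y = 0) (hh x)
        (fun r hr y _ => ?_) (fun y z hy hz => ?_)
      · rw [map_smul, hT r hr]
      · rw [map_add, hy, hz, add_zero]
    rw [Abelian.Ext.mk₀_comp_mk₀, this, Abelian.Ext.mk₀_zero]
  | succ n ih =>
    intro Y _ _ _
    obtain ⟨F, _, _, _, _, p, hp⟩ := Module.exists_finite_presentation R Y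
    obtain ⟨m, hm⟩ := ih (LinearMap.ker p)
    obtain ⟨k₀, hk₀⟩ := Ideal.exists_pow_inf_eq_pow_smul a (LinearMap.ker p)
    refine ⟨m + k₀, fun X _ _ h hh e => ?_⟩
    let b : Ideal R := a ^ (m + k₀)
    obtain ⟨G, _, _, _, q, hq⟩ : ∃ (G : Type u) (_ : AddCommGroup G) (_ : Module R G)
        (_ : Module.Projective R G) (q : G →ₗ[R] X), Function.Surjective q :=
      ⟨X →₀ R, inferInstance, inferInstance, inferInstance, Finsupp.linearCombination R id,
        Finsupp.linearCombination_id_surjective R X⟩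
    obtain ⟨φ, hφb, hφ⟩ := exists_lift_mem_smul_top b hp (h ∘ₗ q) fun x => hh (q x)
    have hφ' : ∀ x ∈ LinearMap.ker q, φ x ∈ LinearMap.ker p := fun x hx => by
      rw [LinearMap.mem_ker]
      exact (LinearMap.congr_fun hφ x).trans ((congrArg h hx).trans (map_zero h))
    let ψ : LinearMap.ker q →ₗ[R] LinearMap.ker p := φ.restrict hφ'
    refine mk₀_comp_eq_zero_of_ker hp hq φ h hφ ψ (fun _ => rfl) (hm _ ψ fun x => ?_) e
    have h1 : (ψ x : F) ∈ b • ⊤ ⊓ LinearMap.ker p := ⟨hφb x, (ψ x).2⟩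
    rw [hk₀ _ (Nat.le_add_left _ _), Nat.add_sub_cancel] at h1
    rw [Submodule.mem_smul_top_iff]
    exact Submodule.smul_mono (le_refl (a ^ m)) (inf_le_right (a := a ^ k₀ • ⊤)) h1

lemma locCoh_succ_subsingleton [IsNoetherianRing R] {a : Ideal R}
    {T : ModuleCat.{u} R} {k : ℕ} (hT : ∀ r ∈ a ^ k, ∀ x : T, r • x = 0) (n : ℕ) :
    Subsingleton (locCoh a T (n + 1)) := by
  refine subsingleton_of_forall_eq 0 fun x => ?_
  obtain ⟨t, e, rfl⟩ := exists_toLocCoh x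
  obtain ⟨m, hm⟩ := exists_pow_forall_mk₀_comp_eq_zero hT n
    (LinearMap.ker (Submodule.mkQ (a ^ t)))
  have hle : a ^ (m + t) ≤ a ^ t := Ideal.pow_le_pow_right (Nat.le_add_left _ _)
  let ψ : LinearMap.ker (Submodule.mkQ (a ^ (m + t))) →ₗ[R]
      LinearMap.ker (Submodule.mkQ (a ^ t)) :=
    Submodule.inclusion (by rw [Submodule.ker_mkQ, Submodule.ker_mkQ]; exact hle)
  rw [← toLocCoh_quotPowMap (Nat.le_add_left t m) e]
  refine (congrArg _ ?_).trans (map_zero _)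
  refine mk₀_comp_eq_zero_of_ker (Submodule.mkQ_surjective _) (Submodule.mkQ_surjective _)
    LinearMap.id _ rfl ψ (fun _ => rfl) (hm _ ψ fun x => ?_) e
  obtain ⟨x, hx⟩ := x
  rw [Submodule.mem_smul_top_iff]
  change x ∈ _
  rw [Submodule.ker_mkQ, pow_add] at hx
  rwa [Submodule.ker_mkQ]

end

noncomputable section

variable {S : ModuleCat.{u} R → Prop} {a : Ideal R}

lemma serre_of_injective (hS : IsSerreClass S) {M N : ModuleCat.{u} R} (f : M →ₗ[R] N)
    (hf : Function.Injective f) (hN : S N) : S M :=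
  hS.iso (LinearEquiv.ofInjective f hf).symm (hS.subobj N (LinearMap.range f) hN)

lemma serre_of_surjective (hS : IsSerreClass S) {M N : ModuleCat.{u} R} (f : M →ₗ[R] N)
    (hf : Function.Surjective f) (hM : S M) : S N :=
  hS.iso (f.quotKerEquivOfSurjective hf) (hS.quot M (LinearMap.ker f) hM)

lemma torsionGamma_locCoh (M : ModuleCat.{u} R) (n : ℕ) :
    torsionGamma a (locCoh a M n) = ⊤ := by
  refine eq_top_iff.mpr fun x _ ↦ ?_
  obtain ⟨t, ht⟩ := exists_forall_smul_eq_zero x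
  exact Submodule.mem_iSup_of_mem t
    ((Submodule.mem_torsionBySet_iff _ _).mpr fun r ↦ ht r r.2)

/-- A finitely generated module whose support has dimension at most `0` is artinian. -/
lemma isArtinian_of_supportDim_le_zero [IsNoetherianRing R] (M : Type u) [AddCommGroup M]
    [Module R M] [Module.Finite R M] (h : Module.supportDim R M ≤ 0) : IsArtinian R M := by
  rw [Module.supportDim_eq_ringKrullDim_quotient_annihilator] at h
  have : Ring.KrullDimLE 0 (R ⧸ Module.annihilator R M) := Ring.krullDimLE_iff.mpr h
  have : IsArtinianRing (R ⧸ Module.annihilator R M) :=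
    isArtinianRing_iff_krullDimLE_zero.mpr this
  let : Module (R ⧸ Module.annihilator R M) M := Module.quotientAnnihilator
  have : IsScalarTower R (R ⧸ Module.annihilator R M) M :=
    Module.IsTorsionBySet.isScalarTower _
  have : Module.Finite (R ⧸ Module.annihilator R M) M :=
    Module.Finite.of_restrictScalars_finite R _ M
  have : IsArtinian (R ⧸ Module.annihilator R M) M := isArtinian_of_fg_of_artinian'
  exact isArtinian_of_surjective_algebraMap
    (Ideal.Quotient.mk_surjective (I := Module.annihilator R M))

lemma serre_locCoh_zero (hfl : ∀ M : ModuleCat.{u} R, IsNoetherian R M → IsArtinian R M → S M)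
    (M : ModuleCat.{u} R) [IsNoetherian R M] [IsArtinian R M] : S (locCoh a M 0) :=
  hfl _ (isNoetherian_of_injective (locCohEvalOne a M) locCohEvalOne_injective)
    (isArtinian_of_injective (locCohEvalOne a M) locCohEvalOne_injective)

/-- If `x ∈ a` is regular on `M` and `H^n_a(M / xM)` lies in a Serre class satisfying `C_a`, then
so does `H^{n+1}_a(M)`. -/
lemma serre_locCoh_succ_of_isSMulRegular (hS : IsSerreClass S) (hC : CCond S a)
    (M : ModuleCat.{u} R) {x : R} (hx : x ∈ a) (reg : IsSMulRegular M x) (n : ℕ)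
    (h : S (locCoh a (ModuleCat.of R (QuotSMulTop x M)) n)) : S (locCoh a M (n + 1)) := by
  refine hC _ (torsionGamma_locCoh M (n + 1)) ?_
  have ex := reg.smulShortComplex_shortExact
  let φ : locCoh a (ModuleCat.of R (QuotSMulTop x M)) n →ₗ[R] locCoh a M (n + 1) :=
    locCohMap ex.extClass rfl
  have hφ : S (ModuleCat.of R (LinearMap.range φ)) :=
    serre_of_surjective hS φ.rangeRestrict φ.surjective_rangeRestrict h
  have hle : Submodule.torsionBySet R (locCoh a M (n + 1)) (a : Set R) ≤ LinearMap.range φ := by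
    intro y hy
    refine exists_locCohMap_eq ex.extClass rfl (Abelian.Ext.mk₀ (M.smulShortComplex x).f)
      (add_zero (n + 1)) (fun X e he ↦ Ext.covariant_sequence_exact₁ X ex e he rfl) y ?_
    exact (locCohMap_smul_id x y).trans ((Submodule.mem_torsionBySet_iff _ _).mp hy ⟨x, hx⟩)
  exact serre_of_injective hS (Submodule.inclusion hle) (Submodule.inclusion_injective hle) hφ

/-- Positive degree local cohomology does not change up to monomorphism when killing a submodule
annihilated by a power of `a`. -/
lemma serre_locCoh_succ_of_quotient [IsNoetherianRing R] (hS : IsSerreClass S)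
    (M : ModuleCat.{u} R) (T : Submodule R M) {k : ℕ} (hT : ∀ r ∈ a ^ k, ∀ y ∈ T, r • y = 0)
    (n : ℕ) (h : S (locCoh a (ModuleCat.of R (M ⧸ T)) (n + 1))) : S (locCoh a M (n + 1)) := by
  have ex := LinearMap.shortExact_shortComplexKer T.mkQ_surjective
  have : Subsingleton (locCoh a (ModuleCat.of R (LinearMap.ker T.mkQ)) (n + 1)) := by
    refine locCoh_succ_subsingleton (k := k) (fun r hr y ↦ Subtype.ext ?_) n
    exact hT r hr _ (by simpa using y.2)
  let φ : locCoh a M (n + 1) →ₗ[R] locCoh a (ModuleCat.of R (M ⧸ T)) (n + 1) :=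
    locCohMap (Abelian.Ext.mk₀ T.mkQ.shortComplexKer.g) (add_zero (n + 1))
  refine serre_of_injective hS φ ((injective_iff_map_eq_zero φ).mpr fun y hy ↦ ?_) h
  obtain ⟨z, rfl⟩ := exists_locCohMap_eq (Abelian.Ext.mk₀ T.mkQ.shortComplexKer.f)
    (add_zero (n + 1)) (Abelian.Ext.mk₀ T.mkQ.shortComplexKer.g) (add_zero (n + 1))
    (fun X e he ↦ Ext.covariant_sequence_exact₂ X ex e he) y hy
  rw [Subsingleton.elim z 0, map_zero]

lemma exists_pow_torsion_and_regular [IsNoetherianRing R] (a : Ideal R) (M : Type u)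
    [AddCommGroup M] [Module R M] [Module.Finite R M] :
    ∃ (T : Submodule R M) (k : ℕ), (∀ r ∈ a ^ k, ∀ y ∈ T, r • y = 0) ∧
      ∃ x ∈ a, IsSMulRegular (M ⧸ T) x := by
  let F : ℕ →o Submodule R M :=
    ⟨fun k ↦ Submodule.torsionBySet R M ((a ^ k : Ideal R) : Set R),
      fun _ _ h ↦ Submodule.torsionBySet_le_torsionBySet_of_subset (Ideal.pow_le_pow_right h)⟩
  obtain ⟨k, hk⟩ := monotone_stabilizes_iff_noetherian.mpr (inferInstanceAs (IsNoetherian R M)) F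
  refine ⟨F k, k, fun r hr y hy ↦ (Submodule.mem_torsionBySet_iff _ _).mp hy ⟨r, hr⟩, ?_⟩
  have : Subsingleton ((R ⧸ a) →ₗ[R] (M ⧸ F k)) := by
    refine subsingleton_of_forall_eq 0 fun f ↦ ?_
    obtain ⟨m, hm⟩ := (F k).mkQ_surjective (f 1)
    have hmem : m ∈ F (k + 1) := by
      refine (Submodule.mem_torsionBySet_iff _ _).mpr fun ⟨r, hr⟩ ↦ ?_
      change r • m = 0
      rw [SetLike.mem_coe, pow_succ] at hr
      induction hr using Submodule.mul_induction_on' with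
      | mem_mul_mem s hs t ht =>
        rw [mul_smul]
        refine (Submodule.mem_torsionBySet_iff _ _).mp (?_ : t • m ∈ F k) ⟨s, hs⟩
        rw [← Submodule.ker_mkQ (F k), LinearMap.mem_ker, map_smul, hm, ← map_smul,
          Algebra.smul_def, mul_one, Ideal.Quotient.algebraMap_eq,
          Ideal.Quotient.eq_zero_iff_mem.mpr ht, map_zero]
      | add s hs t ht h₁ h₂ => rw [add_smul, h₁, h₂, add_zero]
    rw [← hk (k + 1) k.le_succ, ← Submodule.ker_mkQ (F k), LinearMap.mem_ker, hm] at hmem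
    refine LinearMap.ext fun z ↦ ?_
    obtain ⟨r, rfl⟩ := Ideal.Quotient.mk_surjective z
    have : Ideal.Quotient.mk a r = r • (1 : R ⧸ a) := by
      rw [Algebra.smul_def, mul_one, Ideal.Quotient.algebraMap_eq]
    rw [this, map_smul, hmem, smul_zero, LinearMap.zero_apply]
  obtain ⟨x, hx, reg⟩ := IsSMulRegular.subsingleton_linearMap_iff.mp this
  exact ⟨x, by rwa [Ideal.annihilator_quotient] at hx, reg⟩

theorem serre_locCoh_of_supportDim_le [IsNoetherianRing R] (hS : IsSerreClass S) (hC : CCond S a)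
    (hfl : ∀ M : ModuleCat.{u} R, IsNoetherian R M → IsArtinian R M → S M) (n : ℕ) :
    ∀ (M : ModuleCat.{u} R) [Module.Finite R M], Module.supportDim R M ≤ n →
      S (locCoh a M n) := by
  induction n with
  | zero =>
    intro M _ hM
    have := isArtinian_of_supportDim_le_zero M hM
    exact serre_locCoh_zero hfl M
  | succ n ih =>
    intro M _ hM
    obtain ⟨T, k, hT, x, hx, reg⟩ := exists_pow_torsion_and_regular a M
    refine serre_locCoh_succ_of_quotient hS M T hT n
      (serre_locCoh_succ_of_isSMulRegular hS hC (ModuleCat.of R (M ⧸ T)) hx reg n (ih _ ?_))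
    have hle := (Module.supportDim_quotSMulTop_succ_le_of_notMem_minimalPrimes
      fun _ ↦ reg.notMem_of_mem_minimalPrimes).trans
        ((Module.supportDim_le_of_surjective T.mkQ T.mkQ_surjective).trans hM)
    rw [Nat.cast_succ] at hle
    exact (ENat.WithBot.add_le_add_one_right_iff).mp hle

end

end LocalCohomologyAux

/-- Over a noetherian local ring, if a Serre subcategory `S` satisfies `C_a` and contains
every finite length module, and `M` is a nonzero finitely generated module of Krull
dimension `n`, then `H^n_a(M) ∈ S`. -/
theorem stmt19 [IsNoetherianRing R] [IsLocalRing R] (a : Ideal R)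
    (S : ModuleCat.{u} R → Prop)
    (hS : IsSerreClass S)
    (hC : CCond S a)
    (hfl : ∀ M : ModuleCat.{u} R, IsNoetherian R M → IsArtinian R M → S M)
    (M : ModuleCat.{u} R) (hfin : Module.Finite R M) (hnz : Nontrivial M)
    (n : ℕ) (hdim : ringKrullDim (R ⧸ Module.annihilator R M) = n) :
    S ((localCohomology a n).obj M) := by

  exact hS.iso (LocalCohomologyAux.locCohIso a M n).symm.toLinearEquiv
    (LocalCohomologyAux.serre_locCoh_of_supportDim_le hS hC hfl n M
      (Module.supportDim_eq_ringKrullDim_quotient_annihilator R M ▸ hdim.le))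
end
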